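/- Let A be an Albert division algebra over k and φ an automorphism of A. Then φ fixes pointwise some cubic subfield of A; equivalently, the fixed-point subalgebra A^φ properly contains k. -/

import Mathlib

/-- A cubic norm structure `(N, #, c)` on a finite-dimensional `k`-vector space `J`:
a base point `c` with `N c = 1`, a nondegenerate trace bilinear form `T`,
and a quadratic adjoint `#` satisfying the directional-derivative expansion
`N (x + t•y) = N x + t·T(x^#,y) + t²·T(x,y^#) + t³·N y`, the adjoint identity
`x^{##} = N(x)·x`, `c^# = c`, and `c × x = T(x)·c − x`. -/
structure CubicNorm (k J : Type*) [Field k] [AddCommGroup J] [Module k J] where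
  c : J
  N : J → k
  T : J →ₗ[k] J →ₗ[k] k
  sharp : J → J
  base : N c = 1
  expand : ∀ (t : k) (x y : J),
    N (x + t • y) = N x + t * T (sharp x) y + t ^ 2 * T x (sharp y) + t ^ 3 * N y
  nondeg : ∀ x, (∀ y, T x y = 0) → x = 0
  sharp_smul : ∀ (t : k) (x : J), sharp (t • x) = t ^ 2 • sharp x
  adjoint : ∀ x, sharp (sharp x) = N x • x
  sharp_c : sharp c = c
  cross_c : ∀ x, sharp (c + x) - sharp c - sharp x = T x c • c - x

namespace CubicNorm

variable {k J : Type*} [Field k] [AddCommGroup J] [Module k J]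

/-- The Freudenthal cross product `x × y = (x+y)^# − x^# − y^#`. -/
def cross (S : CubicNorm k J) (x y : J) : J :=
  S.sharp (x + y) - S.sharp x - S.sharp y

/-- The `U`-operator `U_a(y) = T(a,y)·a − a^# × y`. -/
def U (S : CubicNorm k J) (a y : J) : J :=
  S.T a y • a - S.cross (S.sharp a) y

end CubicNorm

namespace CubicNorm

variable {k J : Type*} [Field k] [AddCommGroup J] [Module k J] (S : CubicNorm k J)

lemma sharp_zero : S.sharp 0 = 0 := by
  simpa using S.sharp_smul 0 0

lemma N_zero : S.N 0 = 0 := by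
  simpa [S.sharp_zero] using S.expand 1 0 0

lemma N_smul (t : k) (x : J) : S.N (t • x) = t ^ 3 * S.N x := by
  simpa [S.sharp_zero, S.N_zero] using S.expand t 0 x

lemma N_add (x y : J) :
    S.N (x + y) = S.N x + S.T (S.sharp x) y + S.T x (S.sharp y) + S.N y := by
  simpa using S.expand 1 x y

lemma sharp_add (x y : J) : S.sharp (x + y) = S.sharp x + S.sharp y + S.cross x y := by
  simp [cross]

lemma cross_comm (x y : J) : S.cross x y = S.cross y x := by
  simp only [cross, add_comm x y]; abel

lemma T_cross_right_comm (x y z : J) : S.T (S.cross x z) y = S.T (S.cross x y) z := by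
  have h1 := S.N_add (x + z) y
  have h2 := S.N_add (x + y) z
  rw [add_right_comm, h2, S.sharp_add, S.sharp_add, S.N_add, S.N_add] at h1
  simp only [map_add, LinearMap.add_apply] at h1
  have h3 := S.N_add y z
  rw [add_comm y z, S.N_add] at h3
  linear_combination -h3 - h1

lemma T_cross_rotate (x y z : J) : S.T (S.cross x y) z = S.T (S.cross y z) x := by
  rw [S.cross_comm x y, S.T_cross_right_comm]

lemma ext_T {x y : J} (h : ∀ z, S.T x z = S.T y z) : x = y := by
  rw [← sub_eq_zero]
  exact S.nondeg _ fun z => by simp [h z]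

lemma cross_add (x y z : J) : S.cross x (y + z) = S.cross x y + S.cross x z :=
  S.ext_T fun w => by
    rw [map_add, LinearMap.add_apply, S.T_cross_right_comm x w, S.T_cross_right_comm x w,
      S.T_cross_right_comm x w, map_add]

lemma cross_smul (t : k) (x y : J) : S.cross x (t • y) = t • S.cross x y :=
  S.ext_T fun w => by
    rw [map_smul, LinearMap.smul_apply, S.T_cross_right_comm x w, S.T_cross_right_comm x w,
      map_smul]

/-- The Freudenthal cross product as a bilinear map. -/
def crossₗ : J →ₗ[k] J →ₗ[k] J :=
  LinearMap.mk₂ k S.cross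
    (fun x y z => by rw [S.cross_comm, S.cross_add, S.cross_comm z x, S.cross_comm z y])
    (fun t x y => by rw [S.cross_comm, S.cross_smul, S.cross_comm])
    S.cross_add (fun t x y => S.cross_smul t x y)

lemma crossₗ_apply (x y : J) : S.crossₗ x y = S.cross x y := rfl

lemma add_cross (x y z : J) : S.cross (x + y) z = S.cross x z + S.cross y z := by
  simp [← crossₗ_apply]

lemma smul_cross (t : k) (x y : J) : S.cross (t • x) y = t • S.cross x y := by
  simp [← crossₗ_apply]

lemma sub_cross (x y z : J) : S.cross (x - y) z = S.cross x z - S.cross y z := by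
  simp [← crossₗ_apply]

lemma cross_sub (x y z : J) : S.cross z (x - y) = S.cross z x - S.cross z y := by
  simp [← crossₗ_apply]

lemma cross_neg (x y : J) : S.cross x (-y) = -S.cross x y := by
  simp [← crossₗ_apply]

lemma cross_zero (x : J) : S.cross x 0 = 0 := by
  simp [← crossₗ_apply]

lemma zero_cross (x : J) : S.cross 0 x = 0 := by
  simp [← crossₗ_apply]

lemma c_cross (x : J) : S.cross S.c x = S.T x S.c • S.c - x := S.cross_c x

lemma cross_self (x : J) : S.cross x x = (2 : k) • S.sharp x := by
  have h := S.sharp_smul 2 x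
  rw [two_smul, S.sharp_add] at h
  have : S.cross x x = (2 : k) ^ 2 • S.sharp x - S.sharp x - S.sharp x := by
    rw [← h]; abel
  rw [this]; module

lemma c_ne_zero : S.c ≠ 0 := fun h => by
  have := S.base
  rw [h, S.N_zero] at this
  exact zero_ne_one this

lemma T_c_c : S.T S.c S.c = 3 := by
  have h := S.c_cross S.c
  rw [S.cross_self, S.sharp_c] at h
  have h2 : (S.T S.c S.c - 3) • S.c = 0 := by
    have : S.T S.c S.c • S.c = (2 : k) • S.c + S.c := by rw [h]; abel
    rw [sub_smul, this]; module
  exact sub_eq_zero.1 ((smul_eq_zero.1 h2).resolve_right S.c_ne_zero)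

section Infinite

variable [Infinite k]

/-- A polynomial expression in a scalar that vanishes identically has vanishing coefficients. -/
lemma coeff_eq_zero_of_forall {n : ℕ} (a : ℕ → J)
    (h : ∀ t : k, ∑ i ∈ Finset.range n, t ^ i • a i = 0) {i : ℕ} (hi : i < n) : a i = 0 := by
  rw [← Module.forall_dual_apply_eq_zero_iff k]
  intro f
  have hp : (∑ i ∈ Finset.range n, Polynomial.C (f (a i)) * Polynomial.X ^ i) = 0 := by
    apply Polynomial.funext
    intro t
    have := congrArg f (h t)
    simp only [map_sum, map_smul, smul_eq_mul, map_zero] at this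
    simp only [Polynomial.eval_finsetSum, Polynomial.eval_mul, Polynomial.eval_C,
      Polynomial.eval_pow, Polynomial.eval_X, Polynomial.eval_zero]
    rw [← this]
    exact Finset.sum_congr rfl fun _ _ => mul_comm _ _
  have := congrArg (fun p => Polynomial.coeff p i) hp
  simpa [Polynomial.coeff_X_pow, hi] using this

lemma T_c_left (y : J) : S.T S.c y = S.T y S.c := by
  have h : ∀ t : k, ∑ i ∈ Finset.range 4, t ^ i •
      (fun i => if i = 2 then S.T S.c y - S.T y S.c else
        if i = 3 then S.T S.c (S.sharp y) - S.T (S.sharp y) S.c else 0) i = 0 := by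
    intro t
    by_cases ht : t = 0
    · simp [Finset.sum_range_succ, ht]
    have h1 := S.expand t S.c y
    have h2 := S.expand t⁻¹ y S.c
    have h3 : S.c + t • y = t • (y + t⁻¹ • S.c) := by
      rw [smul_add, smul_smul, mul_inv_cancel₀ ht, one_smul, add_comm]
    rw [h3, S.N_smul, h2, S.base, S.sharp_c] at h1
    simp only [Finset.sum_range_succ, Finset.sum_range_zero, smul_eq_mul]
    norm_num
    field_simp at h1
    linear_combination -t * h1
  have := coeff_eq_zero_of_forall _ h (i := 2) (by norm_num)
  simpa [sub_eq_zero] using this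

lemma T_comm (x y : J) : S.T x y = S.T y x := by
  have h := S.T_cross_right_comm S.c x y
  simp only [c_cross, map_sub, map_smul, LinearMap.sub_apply, LinearMap.smul_apply, smul_eq_mul,
    S.T_c_left] at h
  linear_combination h

lemma adjoint_coeffs (x y : J) :
    S.cross (S.sharp x) (S.cross x y) = S.N x • y + S.T (S.sharp x) y • x ∧
    S.cross (S.sharp x) (S.sharp y) + S.sharp (S.cross x y) =
      S.T (S.sharp x) y • y + S.T x (S.sharp y) • x := by
  have h : ∀ t : k, ∑ i ∈ Finset.range 5, t ^ i •
      (fun i => if i = 1 then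
          S.cross (S.sharp x) (S.cross x y) - (S.N x • y + S.T (S.sharp x) y • x)
        else if i = 2 then S.cross (S.sharp x) (S.sharp y) + S.sharp (S.cross x y) -
          (S.T (S.sharp x) y • y + S.T x (S.sharp y) • x)
        else if i = 3 then S.cross (S.sharp y) (S.cross x y) -
          (S.T x (S.sharp y) • y + S.N y • x) else 0) i = 0 := by
    intro t
    have h1 := S.adjoint (x + t • y)
    rw [S.expand, S.sharp_add, S.sharp_smul, S.cross_smul, S.sharp_add, S.sharp_add,
      S.sharp_smul, S.sharp_smul, S.adjoint, S.adjoint, S.add_cross, S.cross_smul,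
      S.cross_smul, S.cross_smul, S.smul_cross] at h1
    have h2 := sub_eq_zero.2 h1
    simp only [Finset.sum_range_succ, Finset.sum_range_zero]
    norm_num
    rw [← h2]
    module
  have h1 := coeff_eq_zero_of_forall _ h (i := 1) (by norm_num)
  have h2 := coeff_eq_zero_of_forall _ h (i := 2) (by norm_num)
  simp only [if_true, OfNat.ofNat_ne_one, if_false, sub_eq_zero] at h1 h2
  exact ⟨h1, h2⟩

lemma sharp_cross_cross (x y : J) :
    S.cross (S.sharp x) (S.cross x y) = S.N x • y + S.T (S.sharp x) y • x :=
  (S.adjoint_coeffs x y).1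

lemma sharp_cross (x y : J) : S.sharp (S.cross x y) =
    S.T (S.sharp x) y • y + S.T x (S.sharp y) • x - S.cross (S.sharp x) (S.sharp y) := by
  rw [← (S.adjoint_coeffs x y).2]; abel

lemma cross_sharp_self (x : J) : S.cross x (S.sharp x) =
    (S.T x S.c * S.T (S.sharp x) S.c - S.N x) • S.c - S.T (S.sharp x) S.c • x
      - S.T x S.c • S.sharp x := by
  have h := S.sharp_cross_cross x S.c
  rw [S.cross_comm x S.c, S.c_cross, S.cross_sub, S.cross_smul, S.cross_comm _ S.c, S.c_cross,
    S.cross_comm _ x] at h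
  have : S.cross x (S.sharp x) = S.T x S.c • (S.T (S.sharp x) S.c • S.c - S.sharp x) -
    (S.N x • S.c + S.T (S.sharp x) S.c • x) := by rw [← h]; abel
  rw [this]; module

lemma cross_cross_self (x y : J) :
    S.T x S.c • S.cross S.c (S.cross x y) - S.cross x (S.cross x y)
      + S.cross (S.sharp x) (S.cross S.c y) =
    S.T (S.sharp x) S.c • y + S.T (S.sharp x) y • S.c + S.T (S.cross x S.c) y • x := by
  have h : ∀ t : k, ∑ i ∈ Finset.range 4, t ^ i •
      (fun i => if i = 1 then
        S.T x S.c • S.cross S.c (S.cross x y) - S.cross x (S.cross x y)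
      + S.cross (S.sharp x) (S.cross S.c y) -
    (S.T (S.sharp x) S.c • y + S.T (S.sharp x) y • S.c + S.T (S.cross x S.c) y • x)
        else if i = 2 then S.cross S.c (S.cross x y) + S.cross (S.cross x S.c) (S.cross S.c y) -
          (S.T S.c y • x + S.T x S.c • y + S.T (S.cross x S.c) y • S.c)
        else if i = 3 then S.cross S.c (S.cross S.c y) - (y + S.T S.c y • S.c)
         else 0) i = 0 := by
    intro t
    have h1 := S.sharp_cross_cross (x + t • S.c) y
    have h0 := S.sharp_cross_cross x y
    rw [S.expand, S.sharp_add, S.sharp_smul, S.cross_smul, S.sharp_c, S.add_cross x,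
      S.smul_cross t, S.base] at h1
    simp only [map_add, map_smul, LinearMap.add_apply, LinearMap.smul_apply, smul_eq_mul,
      S.add_cross, S.cross_add, S.smul_cross, S.cross_smul, h0] at h1
    have h2 := sub_eq_zero.2 h1
    have h3 : S.cross (S.cross x S.c) (S.cross x y) =
        S.T x S.c • S.cross S.c (S.cross x y) - S.cross x (S.cross x y) := by
      rw [S.cross_comm x S.c, S.c_cross, S.sub_cross, S.smul_cross]
    rw [h3] at h2
    simp only [Finset.sum_range_succ, Finset.sum_range_zero]
    norm_num
    rw [← h2]
    module
  have h1 := coeff_eq_zero_of_forall _ h (i := 1) (by norm_num)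
  simpa only [if_true, sub_eq_zero] using h1

end Infinite

end CubicNorm

namespace CubicNorm

variable {k J : Type*} [Field k] [AddCommGroup J] [Module k J] (S : CubicNorm k J) [Infinite k]

lemma T_sharp_self (x : J) : S.T (S.sharp x) x = 3 * S.N x := by
  have h := S.N_add x x
  have h2 := S.N_smul 2 x
  rw [two_smul, h, S.T_comm x] at h2
  have h3 : ∀ t : k, ∑ i ∈ Finset.range 3, t ^ i •
      (fun i => if i = 1 then S.T (S.sharp x) x - 3 * S.N x
        else if i = 2 then S.T (S.sharp x) x - 3 * S.N x else 0) i = 0 := by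
    intro t
    have h1 := S.expand t x x
    have h2 : S.N (x + t • x) = (1 + t) ^ 3 * S.N x := by
      rw [← S.N_smul, add_smul, one_smul]
    rw [h2, S.T_comm x] at h1
    simp only [Finset.sum_range_succ, Finset.sum_range_zero, smul_eq_mul]
    norm_num
    linear_combination -h1
  have := coeff_eq_zero_of_forall _ h3 (i := 1) (by norm_num)
  simpa [sub_eq_zero] using this

lemma cross_sharp_cross {y : J} (hy : S.N y ≠ 0) (z : J) :
    S.cross y (S.cross (S.sharp y) z) = S.N y • z + S.T y z • S.sharp y := by
  have h := S.sharp_cross_cross (S.sharp y) z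
  have hN : S.N (S.sharp y) = S.N y ^ 2 := by
    have h1 := congrArg S.sharp (S.adjoint y)
    rw [S.adjoint, S.sharp_smul] at h1
    have h2 : (S.N (S.sharp y) - S.N y ^ 2) • S.sharp y = 0 := by
      rw [sub_smul, h1, sub_self]
    rcases smul_eq_zero.1 h2 with h3 | h3
    · exact sub_eq_zero.1 h3
    · have h4 := S.adjoint y
      rw [h3, S.sharp_zero] at h4
      rcases smul_eq_zero.1 h4.symm with h5 | h5
      · exact absurd h5 hy
      · rw [h5, S.N_zero] at hy; exact absurd rfl hy
  rw [S.adjoint, S.smul_cross, hN, map_smul, LinearMap.smul_apply, smul_eq_mul] at h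
  have h2 : S.N y • S.cross y (S.cross (S.sharp y) z) =
      S.N y • (S.N y • z + S.T y z • S.sharp y) := by
    rw [h]; module
  exact smul_right_injective J hy h2

lemma N_cross {x y : J} (hx : S.N x ≠ 0) (hy : S.N y ≠ 0) :
    S.N (S.cross x y) = S.T (S.sharp x) y * S.T x (S.sharp y) - S.N x * S.N y := by
  by_cases h0 : S.cross x y = 0
  · have hx0 : x ≠ 0 := fun h => hx (by rw [h, S.N_zero])
    have h1 := S.sharp_cross_cross x y
    rw [h0, S.cross_zero] at h1
    obtain ⟨s, rfl⟩ : ∃ s : k, y = s • x := by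
      refine ⟨-(S.N x)⁻¹ * S.T (S.sharp x) y, ?_⟩
      have h2 : S.N x • y = -(S.T (S.sharp x) y • x) := eq_neg_of_add_eq_zero_left h1.symm
      rw [mul_smul, neg_smul, ← smul_neg, ← h2, smul_smul, inv_mul_cancel₀ hx, one_smul]
    rw [S.cross_smul, S.cross_self, smul_smul] at h0
    have h3 : s * 2 = 0 := by
      refine (smul_eq_zero.1 h0).resolve_right fun h => ?_
      have h4 := S.adjoint x
      rw [h, S.sharp_zero] at h4
      exact (smul_eq_zero.1 h4.symm).elim hx hx0
    rw [S.cross_smul, S.cross_self, smul_smul, h3, zero_smul, S.N_zero, S.sharp_smul, map_smul,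
      map_smul, smul_eq_mul, smul_eq_mul, S.T_comm x, S.T_sharp_self, S.N_smul]
    linear_combination -4 * s ^ 2 * S.N x ^ 2 * h3
  · have h1 := S.adjoint (S.cross x y)
    rw [S.sharp_cross x y] at h1
    have h2 : ∀ a b d : J, S.sharp (a + b - d) = S.sharp a + S.sharp b + S.sharp d
        + S.cross a b - S.cross a d - S.cross b d := by
      intro a b d
      have : S.sharp (-d) = S.sharp d := by
        have := S.sharp_smul (-1) d
        simpa using this
      rw [sub_eq_add_neg, S.sharp_add, S.sharp_add, this, S.cross_neg, S.add_cross]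
      abel
    rw [h2, S.sharp_smul, S.sharp_smul, S.sharp_cross, S.adjoint, S.adjoint] at h1
    simp only [S.smul_cross, S.cross_smul] at h1
    rw [S.cross_sharp_cross hx, S.cross_comm (S.sharp x), S.cross_sharp_cross hy,
      S.cross_comm y x] at h1
    have h3 : (S.N (S.cross x y) -
        (S.T (S.sharp x) y * S.T x (S.sharp y) - S.N x * S.N y)) • S.cross x y = 0 := by
      rw [sub_smul, ← h1]
      simp only [map_smul, LinearMap.smul_apply, smul_eq_mul, S.T_comm y]
      module
    exact sub_eq_zero.1 ((smul_eq_zero.1 h3).resolve_right h0)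

section Automorphism

variable {S} {φ : J →ₗ[k] J}

lemma T_c_map (hN : ∀ x, S.N (φ x) = S.N x) (hc : φ S.c = S.c) (x : J) :
    S.T (φ x) S.c = S.T x S.c := by
  have h : ∀ t : k, ∑ i ∈ Finset.range 4, t ^ i •
      (fun i => if i = 1 then S.T S.c (φ x) - S.T S.c x
        else if i = 2 then S.T S.c (S.sharp (φ x)) - S.T S.c (S.sharp x) else 0) i = 0 := by
    intro t
    have h1 := hN (S.c + t • x)
    rw [map_add, map_smul, hc, S.expand, S.expand, S.sharp_c, hN] at h1
    simp only [Finset.sum_range_succ, Finset.sum_range_zero, smul_eq_mul]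
    norm_num
    linear_combination h1
  have := coeff_eq_zero_of_forall _ h (i := 1) (by norm_num)
  rw [S.T_comm, S.T_comm x]
  simpa [sub_eq_zero] using this

lemma T_sharp_map (hN : ∀ x, S.N (φ x) = S.N x) (x y : J) :
    S.T (S.sharp (φ x)) (φ y) = S.T (S.sharp x) y := by
  have h : ∀ t : k, ∑ i ∈ Finset.range 4, t ^ i •
      (fun i => if i = 1 then S.T (S.sharp (φ x)) (φ y) - S.T (S.sharp x) y
        else if i = 2 then S.T (φ x) (S.sharp (φ y)) - S.T x (S.sharp y) else 0) i = 0 := by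
    intro t
    have h1 := hN (x + t • y)
    rw [map_add, map_smul, S.expand, S.expand, hN, hN] at h1
    simp only [Finset.sum_range_succ, Finset.sum_range_zero, smul_eq_mul]
    norm_num
    linear_combination h1
  have := coeff_eq_zero_of_forall _ h (i := 1) (by norm_num)
  simpa [sub_eq_zero] using this

lemma T_map (hN : ∀ x, S.N (φ x) = S.N x) (hc : φ S.c = S.c) (x y : J) :
    S.T (φ x) (φ y) = S.T x y := by
  have h1 := T_sharp_map hN (S.c + x) y
  rw [map_add, hc, S.sharp_add, S.sharp_add, S.c_cross, S.c_cross, T_c_map hN hc] at h1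
  have h2 := T_sharp_map hN x y
  have h3 := T_c_map hN hc y
  simp only [map_add, map_sub, LinearMap.add_apply, LinearMap.sub_apply, h2, S.sharp_c,
    map_smul, LinearMap.smul_apply, smul_eq_mul, S.T_comm S.c, h3] at h1
  linear_combination -h1

lemma sharp_map (hφ : Function.Surjective φ) (hN : ∀ x, S.N (φ x) = S.N x) (hc : φ S.c = S.c)
    (x : J) : S.sharp (φ x) = φ (S.sharp x) :=
  S.ext_T fun z => by
    obtain ⟨y, rfl⟩ := hφ z
    rw [T_sharp_map hN, T_map hN hc]

lemma cross_map (hφ : Function.Surjective φ) (hN : ∀ x, S.N (φ x) = S.N x) (hc : φ S.c = S.c)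
    (x y : J) : S.cross (φ x) (φ y) = φ (S.cross x y) := by
  simp only [cross, map_sub, ← sharp_map hφ hN hc, map_add]

end Automorphism

end CubicNorm

namespace CubicNorm

open MvPolynomial

variable {k ι : Type*} [Field k] [Fintype ι] [DecidableEq ι] (S : CubicNorm k (ι → k))

lemma exists_sharp_polynomial (s : Finset ι) : ∃ Q : ι → MvPolynomial ι k,
    (∀ i, (Q i).totalDegree ≤ 2) ∧
    ∀ x i, eval x (Q i) = S.sharp (∑ j ∈ s, x j • Pi.single j (1 : k)) i := by
  induction s using Finset.induction_on with
  | empty => exact ⟨0, by simp, by simp [S.sharp_zero]⟩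
  | insert a s ha ih =>
    obtain ⟨Q, hd, hQ⟩ := ih
    refine ⟨fun i => X a ^ 2 * C (S.sharp (Pi.single a 1) i) + Q i +
      X a * ∑ j ∈ s, X j * C (S.cross (Pi.single a 1) (Pi.single j 1) i), fun i => ?_,
      fun x i => ?_⟩
    · refine (totalDegree_add _ _).trans (max_le ((totalDegree_add _ _).trans
        (max_le ?_ (hd i))) ?_)
      · refine (totalDegree_mul _ _).trans ?_
        rw [totalDegree_C, totalDegree_X_pow]
      · refine (totalDegree_mul _ _).trans ?_
        have : (∑ j ∈ s, X j * C (S.cross (Pi.single a 1) (Pi.single j 1) i) :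
            MvPolynomial ι k).totalDegree ≤ 1 := by
          refine totalDegree_finsetSum_le fun j _ => (totalDegree_mul _ _).trans ?_
          rw [totalDegree_C, totalDegree_X]
        rw [totalDegree_X]
        omega
    · have h : S.cross (Pi.single a 1) (∑ j ∈ s, x j • Pi.single j (1 : k)) =
          ∑ j ∈ s, x j • S.cross (Pi.single a 1) (Pi.single j 1) := by
        simp only [← crossₗ_apply, map_sum, map_smul]
      rw [Finset.sum_insert ha, S.sharp_add, S.sharp_smul, S.smul_cross, h]
      simp [hQ, Finset.sum_apply]

lemma exists_norm_polynomial (s : Finset ι) : ∃ P : MvPolynomial ι k,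
    P.totalDegree ≤ 3 ∧ ∀ x, eval x P = S.N (∑ j ∈ s, x j • Pi.single j (1 : k)) := by
  induction s using Finset.induction_on with
  | empty => exact ⟨0, by simp, by simp [S.N_zero]⟩
  | insert a s ha ih =>
    obtain ⟨P, hd, hP⟩ := ih
    obtain ⟨Q, hdQ, hQ⟩ := S.exists_sharp_polynomial s
    refine ⟨P + (∑ i, Q i * C (S.T (Pi.single i 1) (Pi.single a 1))) * X a +
      (∑ j ∈ s, X j * C (S.T (Pi.single j 1) (S.sharp (Pi.single a 1)))) * X a ^ 2 +
      X a ^ 3 * C (S.N (Pi.single a 1)), ?_, fun x => ?_⟩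
    · refine (totalDegree_add _ _).trans (max_le ((totalDegree_add _ _).trans
        (max_le ((totalDegree_add _ _).trans (max_le hd ?_)) ?_)) ?_)
      · refine (totalDegree_mul _ _).trans ?_
        have : (∑ i, Q i * C (S.T (Pi.single i 1) (Pi.single a 1))).totalDegree ≤ 2 := by
          refine totalDegree_finsetSum_le fun j _ => (totalDegree_mul _ _).trans ?_
          rw [totalDegree_C]
          exact hdQ j
        rw [totalDegree_X]
        omega
      · refine (totalDegree_mul _ _).trans ?_
        have : (∑ j ∈ s, X j * C (S.T (Pi.single j 1) (S.sharp (Pi.single a 1))) :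
            MvPolynomial ι k).totalDegree ≤ 1 := by
          refine totalDegree_finsetSum_le fun j _ => (totalDegree_mul _ _).trans ?_
          rw [totalDegree_C, totalDegree_X]
        rw [totalDegree_X_pow]
        omega
      · refine (totalDegree_mul _ _).trans ?_
        rw [totalDegree_C, totalDegree_X_pow]
    · have h : ∀ z : ι → k, S.T z (Pi.single a 1) =
          ∑ i, z i * S.T (Pi.single i 1) (Pi.single a 1) := by
        intro z
        conv_lhs => rw [pi_eq_sum_univ' z]
        simp only [map_sum, map_smul, LinearMap.sum_apply, LinearMap.smul_apply, smul_eq_mul]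
      have h2 : S.T (∑ j ∈ s, x j • Pi.single j (1 : k)) (S.sharp (Pi.single a 1)) =
          ∑ j ∈ s, x j * S.T (Pi.single j 1) (S.sharp (Pi.single a 1)) := by
        simp only [map_sum, map_smul, LinearMap.sum_apply, LinearMap.smul_apply, smul_eq_mul]
      rw [Finset.sum_insert ha, add_comm (x a • _), S.expand, h, h2]
      simp [hP, hQ]
      ring

/-- A polynomial in the coordinates computing the norm. -/
noncomputable def normPoly : MvPolynomial ι k := (S.exists_norm_polynomial Finset.univ).choose

/-- Polynomials in the coordinates computing the adjoint. -/
noncomputable def sharpPoly : ι → MvPolynomial ι k :=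
  (S.exists_sharp_polynomial Finset.univ).choose

lemma sum_smul_single (x : ι → k) : ∑ j, x j • Pi.single j (1 : k) = x := by
  ext i; simp [Finset.sum_apply, Pi.single_apply]

lemma totalDegree_normPoly : S.normPoly.totalDegree ≤ 3 :=
  (S.exists_norm_polynomial Finset.univ).choose_spec.1

lemma totalDegree_sharpPoly (i : ι) : (S.sharpPoly i).totalDegree ≤ 2 :=
  (S.exists_sharp_polynomial Finset.univ).choose_spec.1 i

lemma eval_normPoly (x : ι → k) : eval x S.normPoly = S.N x := by
  rw [normPoly, (S.exists_norm_polynomial Finset.univ).choose_spec.2, sum_smul_single]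

lemma eval_sharpPoly (x : ι → k) (i : ι) : eval x (S.sharpPoly i) = S.sharp x i := by
  rw [sharpPoly, (S.exists_sharp_polynomial Finset.univ).choose_spec.2, sum_smul_single]

/-- A cubic norm structure with anisotropic norm in more than three variables has an infinite
base field. -/
lemma infinite_of_anisotropic (hι : 3 < Fintype.card ι) (hdiv : ∀ x, x ≠ 0 → S.N x ≠ 0) :
    Infinite k := by
  by_contra hfin
  rw [not_infinite_iff_finite] at hfin
  have := Fintype.ofFinite k
  classical
  obtain ⟨p, hp⟩ := CharP.exists k
  have hprime : p.Prime := (CharP.char_is_prime_or_zero k p).resolve_right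
    (CharP.char_ne_zero_of_finite k p)
  have h := char_dvd_card_solutions p (f := S.normPoly)
    (lt_of_le_of_lt S.totalDegree_normPoly hι)
  have h1 : Fintype.card {x : ι → k // eval x S.normPoly = 0} = 1 := by
    rw [Fintype.card_eq_one_iff]
    refine ⟨⟨0, by rw [S.eval_normPoly, S.N_zero]⟩, fun ⟨y, hy⟩ => Subtype.ext ?_⟩
    by_contra h0
    exact hdiv y h0 (by rw [← S.eval_normPoly, hy])
  rw [h1] at h
  exact hprime.one_lt.ne' (Nat.dvd_one.1 h)

section Extend

variable {R R' : Type*} [CommRing R] [Algebra k R] [CommRing R'] [Algebra k R']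

/-- The norm with coordinates in a commutative algebra. -/
noncomputable def NExt (x : ι → R) : R := aeval x S.normPoly

/-- The adjoint with coordinates in a commutative algebra. -/
noncomputable def sharpExt (x : ι → R) : ι → R := fun i => aeval x (S.sharpPoly i)

/-- The trace form with coordinates in a commutative algebra. -/
noncomputable def TExt (x y : ι → R) : R :=
  ∑ i, ∑ j, algebraMap k R (S.T (Pi.single i 1) (Pi.single j 1)) * x i * y j

/-- The base point with coordinates in a commutative algebra. -/
noncomputable def cExt (R : Type*) [CommRing R] [Algebra k R] : ι → R :=
  fun i => algebraMap k R (S.c i)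

lemma map_NExt (f : R →ₐ[k] R') (x : ι → R) : f (S.NExt x) = S.NExt fun i => f (x i) := by
  rw [NExt, NExt, ← comp_aeval_apply]

lemma map_sharpExt (f : R →ₐ[k] R') (x : ι → R) (i : ι) :
    f (S.sharpExt x i) = S.sharpExt (fun i => f (x i)) i := by
  rw [sharpExt, sharpExt, ← comp_aeval_apply]

lemma map_TExt (f : R →ₐ[k] R') (x y : ι → R) :
    f (S.TExt x y) = S.TExt (fun i => f (x i)) fun i => f (y i) := by
  simp [TExt]

lemma map_cExt (f : R →ₐ[k] R') (i : ι) : f (S.cExt R i) = S.cExt R' i := by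
  simp [cExt]

lemma NExt_self (x : ι → k) : S.NExt x = S.N x := by
  rw [← S.eval_normPoly]; rfl

lemma sharpExt_self (x : ι → k) : S.sharpExt x = S.sharp x := by
  ext i; rw [← S.eval_sharpPoly]; rfl

lemma TExt_self (x y : ι → k) : S.TExt x y = S.T x y := by
  conv_rhs => rw [← sum_smul_single x, ← sum_smul_single y]
  simp only [map_sum, map_smul, LinearMap.sum_apply, LinearMap.smul_apply, smul_eq_mul, TExt,
    Algebra.algebraMap_self, RingHom.id_apply, Finset.mul_sum]
  rw [Finset.sum_comm]
  exact Finset.sum_congr rfl fun _ _ => Finset.sum_congr rfl fun _ _ => by ring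

lemma cExt_self : S.cExt k = S.c := rfl

lemma NExt_cExt : S.NExt (S.cExt R) = 1 := by
  have := S.map_NExt (Algebra.ofId k R) (S.cExt k)
  rw [S.NExt_self, S.cExt_self, S.base, map_one] at this
  exact this.symm

lemma sharpExt_cExt : S.sharpExt (S.cExt R) = S.cExt R := by
  ext i
  have := S.map_sharpExt (Algebra.ofId k R) (S.cExt k) i
  rw [S.sharpExt_self, S.cExt_self, S.sharp_c] at this
  exact this.symm

/-- A polynomial identity over an infinite field can be checked on points. -/
lemma eq_of_forall_aeval {σ : Type*} [Infinite k] {p q : MvPolynomial σ k}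
    (h : ∀ v : σ → k, aeval v p = aeval v q) : p = q :=
  MvPolynomial.funext fun v => by simpa using h v

variable [Infinite k]

lemma NExt_add_smul (t : R) (x y : ι → R) :
    S.NExt (fun i => x i + t * y i) = S.NExt x + t * S.TExt (S.sharpExt x) y +
      t ^ 2 * S.TExt x (S.sharpExt y) + t ^ 3 * S.NExt y := by
  have h : S.NExt (R := MvPolynomial (Unit ⊕ ι ⊕ ι) k)
      (fun i => X (.inr (.inl i)) + X (.inl ()) * X (.inr (.inr i))) =
      S.NExt (fun i => X (.inr (.inl i))) + X (.inl ()) *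
        S.TExt (S.sharpExt (fun i => X (.inr (.inl i)))) (fun i => X (.inr (.inr i))) +
      X (.inl ()) ^ 2 *
        S.TExt (fun i => X (.inr (.inl i))) (S.sharpExt (fun i => X (.inr (.inr i)))) +
      X (.inl ()) ^ 3 * S.NExt (fun i => X (.inr (.inr i))) := by
    refine eq_of_forall_aeval fun v => ?_
    simp only [map_add, map_mul, map_pow, map_NExt, map_TExt, map_sharpExt, aeval_X]
    rw [S.NExt_self, S.NExt_self, S.NExt_self, S.TExt_self, S.TExt_self]
    exact (S.expand _ _ _).trans (by rw [sharpExt_self, sharpExt_self])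
  have := congrArg (aeval (Sum.elim (fun _ => t) (Sum.elim x y))) h
  simpa only [map_add, map_mul, map_pow, map_NExt, map_TExt, map_sharpExt, aeval_X,
    Sum.elim_inl, Sum.elim_inr] using this

lemma NExt_smul (t : R) (x : ι → R) : S.NExt (fun i => t * x i) = t ^ 3 * S.NExt x := by
  have h : S.NExt (R := MvPolynomial (Unit ⊕ ι) k) (fun i => X (.inl ()) * X (.inr i)) =
      X (.inl ()) ^ 3 * S.NExt (fun i => X (.inr i)) := by
    refine eq_of_forall_aeval fun v => ?_
    simp only [map_mul, map_pow, map_NExt, aeval_X]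
    rw [S.NExt_self, S.NExt_self]
    exact S.N_smul _ _
  have := congrArg (aeval (Sum.elim (fun _ => t) x)) h
  simpa only [map_mul, map_pow, map_NExt, aeval_X, Sum.elim_inl, Sum.elim_inr] using this

lemma sharpExt_smul (t : R) (x : ι → R) (i : ι) :
    S.sharpExt (fun i => t * x i) i = t ^ 2 * S.sharpExt x i := by
  have h : S.sharpExt (R := MvPolynomial (Unit ⊕ ι) k) (fun i => X (.inl ()) * X (.inr i)) i =
      X (.inl ()) ^ 2 * S.sharpExt (fun i => X (.inr i)) i := by
    refine eq_of_forall_aeval fun v => ?_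
    simp only [map_mul, map_pow, map_sharpExt, aeval_X]
    rw [S.sharpExt_self, S.sharpExt_self]
    exact congrFun (S.sharp_smul _ _) i
  have := congrArg (aeval (Sum.elim (fun _ => t) x)) h
  simpa only [map_mul, map_pow, map_sharpExt, aeval_X, Sum.elim_inl, Sum.elim_inr] using this

lemma sharpExt_sharpExt (x : ι → R) (i : ι) :
    S.sharpExt (S.sharpExt x) i = S.NExt x * x i := by
  have h : S.sharpExt (R := MvPolynomial ι k) (S.sharpExt X) i = S.NExt X * X i := by
    refine eq_of_forall_aeval fun v => ?_
    simp only [map_mul, map_sharpExt, map_NExt, aeval_X]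
    rw [S.NExt_self]
    change S.sharpExt (S.sharpExt v) i = _
    rw [S.sharpExt_self, S.sharpExt_self, S.adjoint]
    rfl
  have := congrArg (aeval x) h
  simpa only [map_mul, map_sharpExt, map_NExt, aeval_X] using this

lemma sharpExt_cExt_add (x : ι → R) (i : ι) :
    S.sharpExt (fun i => S.cExt R i + x i) i - S.cExt R i - S.sharpExt x i =
      S.TExt x (S.cExt R) * S.cExt R i - x i := by
  have h : S.sharpExt (R := MvPolynomial ι k) (fun i => S.cExt _ i + X i) i - S.cExt _ i -
      S.sharpExt X i = S.TExt X (S.cExt _) * S.cExt _ i - X i := by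
    refine eq_of_forall_aeval fun v => ?_
    simp only [map_mul, map_sharpExt, map_TExt, map_cExt, map_sub, map_add, aeval_X]
    rw [S.TExt_self, S.sharpExt_self, S.sharpExt_self]
    have := congrFun (S.cross_c v) i
    rw [S.sharp_c] at this
    exact this
  have := congrArg (aeval x) h
  simpa only [map_mul, map_sharpExt, map_TExt, map_cExt, map_sub, map_add, aeval_X] using this

/-- The norm of the image under a norm-preserving linear map, after extension of scalars. -/
lemma NExt_mulVec (M : Matrix ι ι k) (hM : ∀ x, S.N (M.mulVec x) = S.N x) (x : ι → R) :
    S.NExt ((M.map (algebraMap k R)).mulVec x) = S.NExt x := by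
  have h : S.NExt (R := MvPolynomial ι k)
      ((M.map (algebraMap k (MvPolynomial ι k))).mulVec X) = S.NExt X := by
    refine eq_of_forall_aeval fun v => ?_
    simp only [map_NExt, Matrix.mulVec, dotProduct, map_sum, map_mul, Matrix.map_apply,
      AlgHom.commutes, aeval_X]
    rw [S.NExt_self, S.NExt_self]
    exact hM v
  have := congrArg (aeval x) h
  simp only [map_NExt, Matrix.mulVec, dotProduct, map_sum, map_mul, Matrix.map_apply,
      AlgHom.commutes, aeval_X] at this
  exact this

end Extend

end CubicNorm

namespace CubicNorm

open Polynomial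

variable {k ι : Type*} [Field k] [Fintype ι] [DecidableEq ι] (S : CubicNorm k (ι → k))

lemma NExt_C (a : ι → k) : S.NExt (fun i => C (a i)) = C (S.N a) := by
  have := S.map_NExt (Algebra.ofId k k[X]) a
  rw [NExt_self] at this
  exact this.symm

lemma natDegree_TExt_le (x y : ι → k[X]) (m n : ℕ) (hx : ∀ i, (x i).natDegree ≤ m)
    (hy : ∀ i, (y i).natDegree ≤ n) : (S.TExt x y).natDegree ≤ m + n := by
  refine natDegree_sum_le_of_forall_le _ _ fun i _ =>
    natDegree_sum_le_of_forall_le _ _ fun j _ => ?_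
  rw [mul_assoc]
  refine (natDegree_C_mul_le _ _).trans (natDegree_mul_le.trans (add_le_add (hx i) (hy j)))

lemma natDegree_NExt_le (x : ι → k[X]) (m : ℕ) (hx : ∀ i, (x i).natDegree ≤ m) :
    (S.NExt x).natDegree ≤ 3 * m := by
  rw [NExt]
  exact MvPolynomial.aeval_natDegree_le _ S.totalDegree_normPoly x hx

lemma natDegree_sharpExt_le (x : ι → k[X]) (m : ℕ) (hx : ∀ i, (x i).natDegree ≤ m) (i : ι) :
    (S.sharpExt x i).natDegree ≤ 2 * m := by
  rw [sharpExt]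
  exact MvPolynomial.aeval_natDegree_le _ (S.totalDegree_sharpPoly i) x hx

variable [Infinite k]

lemma coeff_NExt (x : ι → k[X]) (m : ℕ) (hx : ∀ i, (x i).natDegree ≤ m) :
    (S.NExt x).coeff (3 * m) = S.N fun i => (x i).coeff m := by
  set a : ι → k := fun i => (x i).coeff m with ha
  rcases Nat.eq_zero_or_pos m with rfl | hm
  · have : x = fun i => C (a i) := by
      ext1 i
      exact eq_C_of_natDegree_le_zero (hx i)
    rw [this, NExt_C, mul_zero, coeff_C_zero]
  set y : ι → k[X] := fun i => x i - C (a i) * X ^ m with hy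
  have hxy : x = fun i => y i + X ^ m * C (a i) := by
    ext1 i; simp only [hy]; ring
  have hyd : ∀ i, (y i).natDegree ≤ m - 1 := by
    intro i
    rw [natDegree_le_iff_coeff_eq_zero]
    intro n hn
    simp only [hy, coeff_sub, coeff_C_mul, coeff_X_pow]
    split_ifs with h
    · rw [h]; simp [ha]
    · rw [coeff_eq_zero_of_natDegree_lt (lt_of_le_of_lt (hx i) (by omega))]; simp
  have hCa : ∀ i, (C (a i)).natDegree ≤ 0 := fun i => (natDegree_C _).le
  rw [hxy, NExt_add_smul, NExt_C]
  have e1 : (S.NExt y).coeff (3 * m) = 0 :=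
    coeff_eq_zero_of_natDegree_lt (lt_of_le_of_lt (S.natDegree_NExt_le y _ hyd) (by omega))
  have e2 : (X ^ m * S.TExt (S.sharpExt y) fun i => C (a i)).coeff (3 * m) = 0 := by
    refine coeff_eq_zero_of_natDegree_lt (lt_of_le_of_lt (natDegree_mul_le.trans
      (add_le_add (natDegree_X_pow_le m)
        (S.natDegree_TExt_le _ _ _ _ (S.natDegree_sharpExt_le y _ hyd) hCa))) (by omega))
  have e3 : ((X ^ m) ^ 2 * S.TExt y (S.sharpExt fun i => C (a i))).coeff (3 * m) = 0 := by
    rw [← pow_mul]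
    refine coeff_eq_zero_of_natDegree_lt (lt_of_le_of_lt (natDegree_mul_le.trans
      (add_le_add (natDegree_X_pow_le _)
        (S.natDegree_TExt_le _ _ _ _ hyd (S.natDegree_sharpExt_le _ _ hCa)))) (by omega))
  rw [coeff_add, coeff_add, coeff_add, e1, e2, e3, ← pow_mul, mul_comm m 3]
  simp

lemma natDegree_NExt (hdiv : ∀ x, x ≠ 0 → S.N x ≠ 0) (x : ι → k[X]) (hx : x ≠ 0) :
    S.NExt x ≠ 0 ∧ (S.NExt x).natDegree = 3 * Finset.univ.sup fun i => (x i).natDegree := by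
  set m := Finset.univ.sup fun i => (x i).natDegree with hm
  have hle : ∀ i, (x i).natDegree ≤ m := fun i =>
    Finset.le_sup (f := fun i => (x i).natDegree) (Finset.mem_univ i)
  have ha : (fun i => (x i).coeff m) ≠ 0 := by
    obtain ⟨i₀, hi₀⟩ := Function.ne_iff.1 hx
    obtain ⟨i, -, hi⟩ := Finset.exists_mem_eq_sup Finset.univ ⟨i₀, Finset.mem_univ _⟩
      fun i => (x i).natDegree
    rw [← hm] at hi
    intro h
    rcases Nat.eq_zero_or_pos m with h0 | h0
    · have := congrFun h i₀
      rw [show m = (x i₀).natDegree from by have := hle i₀; omega] at this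
      exact hi₀ (leadingCoeff_eq_zero.1 this)
    · have := congrFun h i
      rw [hi] at this
      have := leadingCoeff_eq_zero.1 this
      rw [this] at hi
      simp at hi
      omega
  have hc := S.coeff_NExt x m hle
  have hne : (S.NExt x).coeff (3 * m) ≠ 0 := hc ▸ hdiv _ ha
  exact ⟨fun h => hne (by rw [h, coeff_zero]),
    le_antisymm (S.natDegree_NExt_le x m hle) (le_natDegree_of_ne_zero hne)⟩

end CubicNorm

section PowMul

lemma eq_of_pow_mul_eq_pow_mul {R : Type*} [CommRing R] [IsDomain R] {q u v : R} (hq : q ≠ 0)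
    (hu : ¬ q ∣ u) (hv : ¬ q ∣ v) {a b : ℕ} (h : q ^ a * u = q ^ b * v) : a = b := by
  wlog hab : a ≤ b generalizing a b u v
  · exact (this hv hu h.symm (by omega)).symm
  obtain ⟨c, rfl⟩ := Nat.exists_eq_add_of_le hab
  rw [pow_add, mul_assoc] at h
  have h' := mul_left_cancel₀ (pow_ne_zero _ hq) h
  rcases Nat.eq_zero_or_pos c with rfl | hc
  · rfl
  · exact absurd (h' ▸ Dvd.dvd.mul_right (dvd_pow_self q hc.ne') v) hu

open Polynomial in
/-- A polynomial of degree prime to `3` has an irreducible factor of degree prime to `3` whose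
multiplicity is prime to `3`. -/
lemma exists_irreducible_pow_mul {k : Type*} [Field k] (r : k[X]) (hr : r ≠ 0)
    (h3 : ¬ 3 ∣ r.natDegree) : ∃ (p s : k[X]) (n : ℕ), Irreducible p ∧ r = p ^ n * s ∧ ¬ p ∣ s ∧
      ¬ 3 ∣ n ∧ ¬ 3 ∣ p.natDegree := by
  induction hd : r.natDegree using Nat.strong_induction_on generalizing r with
  | _ d ih =>
    have hnu : ¬ IsUnit r := fun h => h3 (by rw [natDegree_eq_zero_of_isUnit h]; exact dvd_zero _)
    obtain ⟨p, hp, hpr⟩ := WfDvdMonoid.exists_irreducible_factor hnu hr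
    obtain ⟨s, hrs, hps⟩ :=
      (FiniteMultiplicity.of_not_isUnit hp.not_isUnit hr).exists_eq_pow_mul_and_not_dvd
    set n := multiplicity p r
    have hs0 : s ≠ 0 := fun h => hps (h ▸ dvd_zero p)
    have hn : n ≠ 0 := by
      intro h
      rw [h, pow_zero, one_mul] at hrs
      exact hps (hrs ▸ hpr)
    have hdeg : r.natDegree = n * p.natDegree + s.natDegree := by
      rw [hrs, natDegree_mul (pow_ne_zero _ hp.ne_zero) hs0, natDegree_pow]
    by_cases h : 3 ∣ n * p.natDegree
    · have hpd := hp.natDegree_pos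
      have hnp := Nat.mul_pos (Nat.pos_of_ne_zero hn) hpd
      obtain ⟨q, t, m, hq, hst, hqt, hm, hqd⟩ := ih s.natDegree (by omega) s hs0 (by omega) rfl
      refine ⟨q, p ^ n * t, m, hq, by rw [hrs, hst]; ring, fun hdvd => ?_, hm, hqd⟩
      rcases hq.prime.dvd_or_dvd hdvd with h' | h'
      · have hass := (hq.associated_of_dvd hp (hq.prime.dvd_of_dvd_pow h'))
        refine hps (hass.symm.dvd.trans ?_)
        rw [hst]
        exact Dvd.dvd.mul_right (dvd_pow_self q (by rintro rfl; simp at hm)) t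
      · exact hqt h'
    · exact ⟨p, s, n, hp, hrs, hps, fun h' => h (h'.mul_right _), fun h' => h (h'.mul_left _)⟩

end PowMul

namespace CubicNorm

open Polynomial

variable {k ι : Type*} [Field k] [Infinite k] [Fintype ι] [DecidableEq ι]
  (S : CubicNorm k (ι → k))

/-- If the norm stays anisotropic modulo `q`, the multiplicity of `q` in a nonzero norm is
divisible by `3`. -/
lemma three_dvd_multiplicity {q : k[X]} (hq : Irreducible q)
    (hS : ∀ x : ι → k[X], q ∣ S.NExt x → ∀ i, q ∣ x i) (y : ι → k[X]) (hy : y ≠ 0)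
    {n : ℕ} {s : k[X]} (hs : ¬ q ∣ s) (h : S.NExt y = q ^ n * s) : 3 ∣ n := by
  have hex : ∃ t, ¬ ∀ i, q ^ t ∣ y i := by
    obtain ⟨i, hi⟩ := Function.ne_iff.1 hy
    obtain ⟨t, ht⟩ := FiniteMultiplicity.of_not_isUnit hq.not_isUnit hi
    exact ⟨t + 1, fun h => ht (h i)⟩
  classical
  obtain ⟨t, ht⟩ : ∃ t, t + 1 = Nat.find hex :=
    Nat.exists_eq_add_one.2 (Nat.pos_of_ne_zero fun h0 => by
      have := Nat.find_spec hex
      rw [h0] at this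
      simp at this) |>.imp fun _ h => h.symm
  have h1 : ∀ i, q ^ t ∣ y i := by
    by_contra hcon
    exact Nat.find_min hex (by omega) hcon
  choose z hz using h1
  have h2 : ¬ ∀ i, q ∣ z i := fun h' => Nat.find_spec hex fun i => by
    rw [← ht, hz i, pow_succ]
    exact mul_dvd_mul_left _ (h' i)
  have h3 : S.NExt y = q ^ (t * 3) * S.NExt z := by
    rw [show y = fun i => q ^ t * z i from _root_.funext hz, S.NExt_smul, pow_mul]
  rw [h] at h3
  exact ⟨t, by
    rw [mul_comm 3]
    exact eq_of_pow_mul_eq_pow_mul hq.ne_zero hs (fun h' => h2 (hS z h')) h3⟩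

/-- A Springer-type theorem: an anisotropic norm stays anisotropic over extensions of degree
prime to `3`. -/
theorem dvd_of_dvd_NExt (hdiv : ∀ x, x ≠ 0 → S.N x ≠ 0) (p : k[X]) (hp : Irreducible p)
    (h3 : ¬ 3 ∣ p.natDegree) (x : ι → k[X]) (hx : p ∣ S.NExt x) (i : ι) : p ∣ x i := by
  induction hd : p.natDegree using Nat.strong_induction_on generalizing p x i with
  | _ d ih =>
    by_contra hxi
    obtain ⟨w, hw, j, hwj⟩ : ∃ w : ι → k[X], (∀ i, p ∣ S.sharpExt w i) ∧ ∃ j, ¬ p ∣ w j := by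
      by_cases h : ∀ i, p ∣ S.sharpExt x i
      · exact ⟨x, h, i, hxi⟩
      · push Not at h
        exact ⟨S.sharpExt x, fun i => by
          rw [S.sharpExt_sharpExt]
          exact hx.mul_right _, h⟩
    obtain ⟨x, hx, hxd, hxj⟩ : ∃ x : ι → k[X], (∀ i, p ∣ S.sharpExt x i) ∧
        (∀ i, (x i).natDegree ≤ d - 1) ∧ ¬ p ∣ x j := by
      have hmod : ∀ i, AdjoinRoot.mk p (w i % p) = AdjoinRoot.mk p (w i) := fun i => by
        rw [AdjoinRoot.mk_eq_mk]
        exact ⟨-(w i / p), by linear_combination EuclideanDomain.mod_add_div (w i) p⟩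
      refine ⟨fun i => w i % p, fun i => ?_, fun i => ?_, ?_⟩
      · rw [← AdjoinRoot.mk_eq_zero]
        have h1 := S.map_sharpExt (AdjoinRoot.mkₐ p) (fun i => w i % p) i
        have h2 := S.map_sharpExt (AdjoinRoot.mkₐ p) w i
        simp only [AdjoinRoot.coe_mkₐ, hmod] at h1 h2
        rw [h1, ← h2, AdjoinRoot.mk_eq_zero]
        exact hw i
      · have := natDegree_mod_lt (w i) (q := p) hp.natDegree_pos.ne'
        change (w i % p).natDegree ≤ d - 1
        omega
      · rw [← AdjoinRoot.mk_eq_zero, hmod, AdjoinRoot.mk_eq_zero]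
        exact hwj
    have hx0 : x ≠ 0 := by
      rintro rfl
      exact hxj (dvd_zero p)
    obtain ⟨hN0, hNd⟩ := S.natDegree_NExt hdiv x hx0
    have hxd' : (Finset.univ.sup fun i => (x i).natDegree) ≤ d - 1 :=
      Finset.sup_le fun i _ => hxd i
    choose y hy using hx
    have hxy : S.sharpExt x = fun i => p * y i := _root_.funext hy
    have hNx : ∀ i, S.NExt x * x i = p ^ 2 * S.sharpExt y i := fun i => by
      rw [← S.sharpExt_sharpExt, hxy, S.sharpExt_smul]
    obtain ⟨r, hr⟩ : p ^ 2 ∣ S.NExt x :=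
      hp.prime.pow_dvd_of_dvd_mul_right 2 hxj ⟨_, hNx j⟩
    have hr0 : r ≠ 0 := by
      rintro rfl
      exact hN0 (by rw [hr, mul_zero])
    have hyr : S.sharpExt y = fun i => r * x i := by
      ext1 i
      have := hNx i
      rw [hr, mul_assoc] at this
      exact (mul_left_cancel₀ (pow_ne_zero 2 hp.ne_zero) this).symm
    have hy0 : y ≠ 0 := by
      rintro rfl
      have h := S.sharpExt_smul (0 : k[X]) x j
      simp only [zero_mul, ne_eq, OfNat.ofNat_ne_zero, not_false_eq_true, zero_pow] at h
      have h' := congrFun hyr j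
      change S.sharpExt (fun _ => 0) j = _ at h'
      rw [h] at h'
      rcases mul_eq_zero.1 h'.symm with h'' | h''
      · exact hr0 h''
      · exact hxj (h'' ▸ dvd_zero p)
    have hNy : S.NExt y = r ^ 2 * p := by
      obtain ⟨i, hi⟩ := Function.ne_iff.1 hy0
      have h := S.sharpExt_sharpExt y i
      rw [hyr, S.sharpExt_smul, hy, ← mul_assoc] at h
      exact (mul_right_cancel₀ hi h).symm
    have hdeg : 3 * (Finset.univ.sup fun i => (x i).natDegree) = 2 * d + r.natDegree := by
      rw [← hNd, hr, natDegree_mul (pow_ne_zero 2 hp.ne_zero) hr0, natDegree_pow, hd]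
    obtain ⟨q, s, n, hq, hrs, hqs, hn, hq3⟩ := exists_irreducible_pow_mul r hr0 (by omega)
    have hn0 : n ≠ 0 := by rintro rfl; simp at hn
    have hqr : q.natDegree ≤ r.natDegree :=
      natDegree_le_of_dvd (hrs ▸ Dvd.dvd.mul_right (dvd_pow_self q hn0) s) hr0
    have hp1 := hp.natDegree_pos
    have hqd : q.natDegree < d := by omega
    have hqp : ¬ q ∣ p := fun h => by
      have := natDegree_eq_of_degree_eq
        (degree_eq_degree_of_associated (hq.associated_of_dvd hp h))
      omega
    have := S.three_dvd_multiplicity hq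
      (fun x hx i => ih _ hqd q hq hq3 x hx i rfl) y hy0 (n := n * 2) (s := s ^ 2 * p)
      (fun h => by
        rcases hq.prime.dvd_or_dvd h with h | h
        · exact hqs (hq.prime.dvd_of_dvd_pow h)
        · exact hqp h) (by rw [hNy, hrs, pow_mul]; ring)
    omega

/-- An anisotropic norm stays anisotropic over simple extensions of degree prime to `3`. -/
theorem eq_zero_of_NExt_adjoinRoot (hdiv : ∀ x, x ≠ 0 → S.N x ≠ 0) (p : k[X])
    (hp : Irreducible p) (h3 : ¬ 3 ∣ p.natDegree) (x : ι → AdjoinRoot p) (hx : S.NExt x = 0) :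
    x = 0 := by
  choose y hy using fun i => AdjoinRoot.mk_surjective (x i)
  have h := S.map_NExt (AdjoinRoot.mkₐ p) y
  simp only [AdjoinRoot.coe_mkₐ, hy] at h
  rw [show (fun i => x i) = x from rfl, hx, AdjoinRoot.mk_eq_zero] at h
  ext1 i
  rw [← hy i, Pi.zero_apply, AdjoinRoot.mk_eq_zero]
  exact S.dvd_of_dvd_NExt hdiv p hp h3 y h i

end CubicNorm

namespace CubicNorm

open Polynomial

/-- In the presence of cube roots of unity, irreducible factors of `X ^ 3 - 1` are linear. -/
lemma exists_of_dvd_X_pow_three_sub_one {k : Type*} [Field k] {α : k}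
    (hα : α ^ 2 + α + 1 = 0) {p : k[X]} (hp : Irreducible p) (h : p ∣ X ^ 3 - 1) :
    ∃ a, a ^ 3 = 1 ∧ Associated p (X - C a) := by
  have h0 : (X ^ 3 - 1 : k[X]) = (X - C 1) * ((X - C α) * (X - C (α ^ 2))) := by
    have h1 : (C α : k[X]) ^ 2 + C α + 1 = 0 := by
      rw [← C_pow, ← C_1, ← C_add, ← C_add, hα, C_0]
    simp only [C_1, C_pow]
    linear_combination (X ^ 2 - C α * X + C α - 1) * h1
  have hα3 : α ^ 3 = 1 := by linear_combination (α - 1) * hα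
  rw [h0] at h
  have hass : ∀ a : k, p ∣ X - C a → Associated p (X - C a) := fun a ha =>
    hp.associated_of_dvd (irreducible_X_sub_C a) ha
  rcases hp.prime.dvd_or_dvd h with h | h
  · exact ⟨1, one_pow 3, hass _ h⟩
  rcases hp.prime.dvd_or_dvd h with h | h
  · exact ⟨α, hα3, hass _ h⟩
  · exact ⟨α ^ 2, by rw [← pow_mul, mul_comm, pow_mul, hα3, one_pow], hass _ h⟩

variable {k ι : Type*} [Field k] [Infinite k] [Fintype ι] [DecidableEq ι]
  (S : CubicNorm k (ι → k))

/-- An irreducible factor of degree prime to `3` of the characteristic polynomial of a norm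
isometry divides `X ^ 3 - 1`. -/
lemma dvd_X_pow_three_sub_one (hdiv : ∀ x, x ≠ 0 → S.N x ≠ 0) (φ : (ι → k) →ₗ[k] (ι → k))
    (hN : ∀ x, S.N (φ x) = S.N x) {p : k[X]} (hp : Irreducible p) (h3 : ¬ 3 ∣ p.natDegree)
    (hdvd : p ∣ φ.charpoly) : p ∣ X ^ 3 - 1 := by
  have := Fact.mk hp
  set M := LinearMap.toMatrix' φ with hM
  have hMφ : ∀ x, M.mulVec x = φ x := fun x => LinearMap.toMatrix'_mulVec φ x
  set M' := M.map (algebraMap k (AdjoinRoot p)) with hM'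
  have hroot : M'.charpoly.eval (AdjoinRoot.root p) = 0 := by
    rw [hM', Matrix.charpoly_map, eval_map_algebraMap, AdjoinRoot.aeval_eq, AdjoinRoot.mk_eq_zero,
      hM, ← LinearMap.toMatrix_eq_toMatrix', LinearMap.charpoly_toMatrix]
    exact hdvd
  rw [Matrix.eval_charpoly] at hroot
  obtain ⟨v, hv0, hv⟩ := Matrix.exists_mulVec_eq_zero_iff.2 hroot
  rw [Matrix.sub_mulVec, sub_eq_zero] at hv
  have h1 := S.NExt_mulVec M (fun x => by rw [hMφ, hN]) v
  rw [← hM', ← hv] at h1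
  have h2 : Matrix.mulVec (Matrix.scalar ι (AdjoinRoot.root p)) v =
      fun i => AdjoinRoot.root p * v i := by
    ext i
    simp [Matrix.mulVec_diagonal]
  rw [h2, S.NExt_smul] at h1
  have h4 : S.NExt v ≠ 0 := fun h => hv0 (S.eq_zero_of_NExt_adjoinRoot hdiv p hp h3 v h)
  rw [← AdjoinRoot.mk_eq_zero]
  simp only [map_sub, map_pow, AdjoinRoot.mk_X, map_one]
  have := mul_right_cancel₀ h4 (h1.trans (one_mul _).symm)
  rw [this, sub_self]

end CubicNorm

section TwistedCommutation

open Polynomial Module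

lemma three_dvd_of_natCast_eq_zero {E : Type*} [Field E] (h3 : (3 : E) = 0) {n : ℕ}
    (hn : (n : E) = 0) : 3 ∣ n := by
  have h : ((n % 3 : ℕ) : E) = 0 := by
    rw [← Nat.mod_add_div n 3] at hn
    push_cast at hn
    rwa [h3, zero_mul, add_zero] at hn
  have hlt : n % 3 < 3 := Nat.mod_lt _ (by norm_num)
  interval_cases hm : n % 3
  · exact Nat.dvd_of_mod_eq_zero hm
  · simp at h
  · refine absurd ?_ (one_ne_zero (α := E))
    push_cast at h
    linear_combination h3 - h

lemma three_dvd_finrank {E M : Type*} [Field E] [AddCommGroup M] [Module E M]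
    [FiniteDimensional E M] (R φ : M →ₗ[E] M) (α β : E) (hα : α ^ 3 = 1)
    (hφ : Function.Injective φ) (h : ∀ x, φ (R x) = α • R (φ x) + β • φ x)
    (hcase : (α ≠ 1 ∧ β = 0 ∧ Function.Injective R) ∨ (α = 1 ∧ β = 1 ∧ (3 : E) = 0)) :
    3 ∣ finrank E M := by
  have hdet : ∀ f : M →ₗ[E] M, Function.Injective f → LinearMap.det f ≠ 0 := fun f hf =>
    ((LinearMap.isUnit_iff_isUnit_det f).1
      ((Module.End.isUnit_iff f).2 ⟨hf, LinearMap.injective_iff_surjective.1 hf⟩)).ne_zero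
  rcases hcase with ⟨hα1, rfl, hR⟩ | ⟨rfl, rfl, h3⟩
  · have h1 : φ ∘ₗ R = α • (R ∘ₗ φ) := by
      ext x
      simp [h]
    have h2 := congrArg LinearMap.det h1
    rw [LinearMap.det_smul, LinearMap.det_comp, LinearMap.det_comp] at h2
    have h4 : α ^ finrank E M = 1 := by
      refine mul_right_cancel₀ (mul_ne_zero (hdet φ hφ) (hdet R hR)) ?_
      rw [one_mul, mul_comm (LinearMap.det φ), ← h2, mul_comm]
    have := orderOf_eq_prime (p := 3) hα hα1
    rw [← this]
    exact orderOf_dvd_of_pow_eq_one h4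
  · let e : M ≃ₗ[E] M := LinearEquiv.ofInjectiveEndo φ hφ
    have he : ∀ x, e x = φ x := fun x => rfl
    have h1 : e.conj R = R + 1 := by
      ext x
      obtain ⟨y, rfl⟩ := e.surjective x
      rw [LinearEquiv.conj_apply_apply, e.symm_apply_apply, he, he, h]
      simp
    have h2 := LinearMap.trace_conj' R e
    rw [h1, map_add, LinearMap.trace_one] at h2
    exact three_dvd_of_natCast_eq_zero h3 (by simpa using h2)

lemma finrank_mul_three_dvd_finrank {k E M : Type*} [Field k] [Field E] [Algebra k E]
    [AddCommGroup M] [Module k M] [Module E M] [IsScalarTower k E M] [FiniteDimensional k M]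
    (R φ : M →ₗ[k] M) (hER : ∀ (e : E) x, R (e • x) = e • R x)
    (hEφ : ∀ (e : E) x, φ (e • x) = e • φ x) (α β : k) (hα : α ^ 3 = 1)
    (hφ : Function.Injective φ) (h : ∀ x, φ (R x) = α • R (φ x) + β • φ x)
    (hcase : (α ≠ 1 ∧ β = 0 ∧ Function.Injective R) ∨ (α = 1 ∧ β = 1 ∧ (3 : k) = 0)) :
    finrank k E * 3 ∣ finrank k M := by
  have : FiniteDimensional E M := FiniteDimensional.right k E M
  rw [← finrank_mul_finrank k E M]
  refine mul_dvd_mul_left _ (three_dvd_finrank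
    { R with map_smul' := hER } { φ with map_smul' := hEφ }
    (algebraMap k E α) (algebraMap k E β) (by rw [← map_pow, hα, map_one]) hφ (fun x => ?_) ?_)
  · rw [algebraMap_smul, algebraMap_smul]
    exact h x
  · rcases hcase with ⟨h1, h2, h4⟩ | ⟨h1, h2, h4⟩
    · refine Or.inl ⟨fun h' => h1 ((algebraMap k E).injective (by rw [h', map_one])),
        by rw [h2, map_zero], h4⟩
    · refine Or.inr ⟨by rw [h1, map_one], by rw [h2, map_one], ?_⟩
      rw [← map_ofNat (algebraMap k E) 3, h4, map_zero]

lemma commute_aeval_of_commute {k A : Type*} [CommSemiring k] [Semiring A] [Algebra k A] {a b : A}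
    (h : Commute a b) (f : k[X]) : Commute (aeval a f) b := by
  induction f using Polynomial.induction_on' with
  | add p q hp hq => rw [map_add]; exact hp.add_left hq
  | monomial n c =>
    rw [aeval_monomial]
    exact (show Commute (algebraMap k A c) b from Algebra.commutes c b).mul_left (h.pow_left n)

lemma coe_aeval_restrict {k M : Type*} [Field k] [AddCommGroup M] [Module k M] (ψ : M →ₗ[k] M)
    (p : Submodule k M) (h : ∀ x ∈ p, ψ x ∈ p) (f : k[X]) (x : p) :
    (aeval (ψ.restrict h) f x : M) = aeval ψ f x := by
  induction f using Polynomial.induction_on' with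
  | add p q hp hq => simp [hp, hq]
  | monomial n c =>
    simp only [aeval_monomial, Module.End.mul_apply, Module.End.pow_restrict n,
      Module.algebraMap_end_apply, Submodule.coe_smul, LinearMap.restrict_apply]

/-- An operator `ψ` annihilated by a polynomial all of whose prime factors have degree divisible by
`3`, in the presence of operators commuting with `ψ` and satisfying a twisted commutation
relation, acts on a space of dimension divisible by `9`. -/
theorem nine_dvd_finrank {k : Type*} [Field k] (α β : k) (hα : α ^ 3 = 1)
    (hcase : (α ≠ 1 ∧ β = 0) ∨ (α = 1 ∧ β = 1 ∧ (3 : k) = 0)) (q : k[X]) (hq0 : q ≠ 0)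
    (hq : ∀ g, Irreducible g → g ∣ q → 3 ∣ g.natDegree)
    {M : Type*} [AddCommGroup M] [Module k M] [FiniteDimensional k M] (R φ ψ : M →ₗ[k] M)
    (hψR : Commute ψ R) (hψφ : Commute ψ φ) (hφ : Function.Injective φ)
    (hR : Function.Injective R)
    (h : ∀ x, φ (R x) = α • R (φ x) + β • φ x) (hψ : aeval ψ q = 0) : 9 ∣ finrank k M := by
  induction q using WfDvdMonoid.induction_on_irreducible generalizing M with
  | zero => exact absurd rfl hq0
  | unit u hu =>
    have h1 : IsUnit (aeval ψ u) := hu.map _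
    rw [hψ] at h1
    have h2 : Subsingleton M := ⟨fun x y => by
      have h3 := (Module.End.isUnit_iff _).1 h1
      exact h3.1 rfl⟩
    rw [finrank_zero_of_subsingleton]
    exact dvd_zero _
  | mul q g hq' hg ih =>
    set G := aeval ψ g with hG
    have hGR : Commute G R := commute_aeval_of_commute hψR g
    have hGφ : Commute G φ := commute_aeval_of_commute hψφ g
    have hGψ : Commute G ψ := commute_aeval_of_commute (Commute.refl ψ) g
    have hker : ∀ f : M →ₗ[k] M, Commute G f → ∀ x ∈ LinearMap.ker G, f x ∈ LinearMap.ker G := by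
      intro f hf x hx
      rw [LinearMap.mem_ker] at hx ⊢
      have := LinearMap.congr_fun hf.eq x
      simp only [Module.End.mul_apply] at this
      rw [this, hx, map_zero]
    have hran : ∀ f : M →ₗ[k] M, Commute G f →
        ∀ x ∈ LinearMap.range G, f x ∈ LinearMap.range G := by
      rintro f hf _ ⟨y, rfl⟩
      have := LinearMap.congr_fun hf.eq y
      simp only [Module.End.mul_apply] at this
      exact ⟨f y, this⟩
    rw [← LinearMap.finrank_range_add_finrank_ker G]
    refine dvd_add ?_ ?_
    · refine ih hq' (fun g' hg' hd => hq g' hg' (hd.mul_left g)) (R.restrict (hran R hGR))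
        (φ.restrict (hran φ hGφ)) (ψ.restrict (hran ψ hGψ)) ?_ ?_ ?_ ?_ ?_ ?_
      · ext ⟨x, hx⟩
        exact LinearMap.congr_fun hψR.eq x
      · ext ⟨x, hx⟩
        exact LinearMap.congr_fun hψφ.eq x
      · exact fun x y hxy => Subtype.ext (hφ (congrArg Subtype.val hxy))
      · exact fun x y hxy => Subtype.ext (hR (congrArg Subtype.val hxy))
      · exact fun x => Subtype.ext (h x)
      · ext ⟨x, y, rfl⟩
        rw [coe_aeval_restrict]
        have h2 := LinearMap.congr_fun hψ y
        rw [mul_comm, map_mul] at h2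
        exact h2
    · have hfact := Fact.mk hg
      have hK : aeval (ψ.restrict (hker ψ hGψ)) g = 0 := by
        ext ⟨x, hx⟩
        rw [coe_aeval_restrict]
        exact hx
      let F : AdjoinRoot g →ₐ[k] Module.End k (LinearMap.ker G) :=
        Ideal.Quotient.liftₐ (Ideal.span {g}) (aeval (ψ.restrict (hker ψ hGψ))) fun a ha => by
          obtain ⟨b, rfl⟩ := Ideal.mem_span_singleton'.1 ha
          rw [map_mul, hK, mul_zero]
      let _ : Module (AdjoinRoot g) (LinearMap.ker G) := Module.compHom _ F.toRingHom
      have hsmul : ∀ (e : AdjoinRoot g) (x : LinearMap.ker G), e • x = F e x := fun _ _ => rfl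
      have hF : ∀ f : k[X], F (AdjoinRoot.mk g f) = aeval (ψ.restrict (hker ψ hGψ)) f :=
        fun f => rfl
      have : IsScalarTower k (AdjoinRoot g) (LinearMap.ker G) := by
        refine ⟨fun c e x => ?_⟩
        rw [hsmul, hsmul, map_smul]
        rfl
      have hcom : ∀ (f : M →ₗ[k] M) (hf : Commute G f), Commute ψ f → ∀ (e : AdjoinRoot g) x,
          f.restrict (hker f hf) (e • x) = e • f.restrict (hker f hf) x := by
        intro f hf hψf e x
        obtain ⟨e, rfl⟩ := AdjoinRoot.mk_surjective e
        rw [hsmul, hsmul, hF]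
        have h1 : Commute (ψ.restrict (hker ψ hGψ)) (f.restrict (hker f hf)) := by
          ext ⟨x, hx⟩
          exact LinearMap.congr_fun hψf.eq x
        exact (LinearMap.congr_fun (commute_aeval_of_commute h1 e).eq x).symm
      have h9 := finrank_mul_three_dvd_finrank (E := AdjoinRoot g) (R.restrict (hker R hGR))
        (φ.restrict (hker φ hGφ)) (hcom R hGR hψR) (hcom φ hGφ hψφ) α β hα
        (fun x y hxy => Subtype.ext (hφ (congrArg Subtype.val hxy))) (fun x => Subtype.ext (h x))
        (hcase.imp_left fun h' => ⟨h'.1, h'.2,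
          fun x y hxy => Subtype.ext (hR (congrArg Subtype.val hxy))⟩)
      have hfin : finrank k (AdjoinRoot g) = g.natDegree := finrank_quotient_span_eq_natDegree
      rw [hfin] at h9
      exact (mul_dvd_mul_right (hq g hg (dvd_mul_right g q)) 3).trans h9

end TwistedCommutation

namespace CubicNorm

variable {k J : Type*} [Field k] [AddCommGroup J] [Module k J]

/-- A nonzero vector `v` mapped by the automorphism `φ` to `α • v + β • c`, where either `α` is a
primitive cube root of unity and `β = 0`, or `α = β = 1` in characteristic `3`. -/
structure IsTwisted (S : CubicNorm k J) (φ : J →ₗ[k] J) (α β : k) (v : J) : Prop where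
  norm_map : ∀ x, S.N (φ x) = S.N x
  map_c : φ S.c = S.c
  surjective : Function.Surjective φ
  quadratic : α ^ 2 + α + 1 = 0
  dichotomy : (α ≠ 1 ∧ β = 0) ∨ (α = 1 ∧ β = 1 ∧ (3 : k) = 0)
  map_v : φ v = α • v + β • S.c
  norm_ne_zero : S.N v ≠ 0

/-- The orthogonal complement of `c`, `v` and `v^#`. -/
def orth (S : CubicNorm k J) (v : J) : Submodule k J :=
  LinearMap.ker (S.T S.c) ⊓ LinearMap.ker (S.T v) ⊓ LinearMap.ker (S.T (S.sharp v))

lemma mem_orth {S : CubicNorm k J} {v x : J} :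
    x ∈ S.orth v ↔ (S.T S.c x = 0 ∧ S.T v x = 0) ∧ S.T (S.sharp v) x = 0 := Iff.rfl

lemma c_cross_of_mem_orth [Infinite k] (S : CubicNorm k J) {v x : J} (hx : x ∈ S.orth v) :
    S.cross S.c x = -x := by
  rw [S.c_cross, S.T_comm, (mem_orth.1 hx).1.1, zero_smul, zero_sub]

lemma sharp_cross_cross_of_mem_orth [Infinite k] (S : CubicNorm k J) {v x : J} (hx : x ∈ S.orth v) :
    S.cross (S.sharp v) (S.cross v x) = S.N v • x := by
  rw [S.sharp_cross_cross, (mem_orth.1 hx).2, zero_smul, add_zero]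

namespace IsTwisted

variable {S : CubicNorm k J} {φ : J →ₗ[k] J} {α β : k} {v : J}

lemma pow_three (h : S.IsTwisted φ α β v) : α ^ 3 = 1 := by linear_combination (α - 1) * h.quadratic

lemma ne_zero (h : S.IsTwisted φ α β v) : α ≠ 0 := fun h0 => by
  have := h.quadratic
  simp [h0] at this

variable [Infinite k]

lemma T_v_c (h : S.IsTwisted φ α β v) : S.T v S.c = 0 := by
  have h1 := T_map h.norm_map h.map_c v S.c
  rw [h.map_c, h.map_v] at h1
  rcases h.dichotomy with ⟨hα, rfl⟩ | ⟨rfl, rfl, h3⟩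
  · simp only [zero_smul, add_zero, map_smul, LinearMap.smul_apply, smul_eq_mul] at h1
    have h2 : (α - 1) * S.T v S.c = 0 := by linear_combination h1
    exact (mul_eq_zero.1 h2).resolve_left (sub_ne_zero.2 hα)
  · have h2 := T_map h.norm_map h.map_c (S.sharp v) S.c
    rw [h.map_c, ← sharp_map h.surjective h.norm_map h.map_c, h.map_v, one_smul, one_smul,
      S.sharp_add, S.cross_comm, S.c_cross, S.sharp_c] at h2
    simp only [map_add, map_sub, map_smul, LinearMap.add_apply, LinearMap.sub_apply,
      LinearMap.smul_apply, smul_eq_mul, S.T_c_c] at h2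
    linear_combination -h2 + (S.T v S.c + 1) * h3

lemma T_sharp_c (h : S.IsTwisted φ α β v) : S.T (S.sharp v) S.c = -β := by
  have h1 := h.norm_map v
  rw [h.map_v, S.N_add, S.sharp_smul, S.sharp_smul, S.N_smul, S.N_smul, S.base, S.sharp_c] at h1
  simp only [map_smul, LinearMap.smul_apply, smul_eq_mul, h.T_v_c, h.pow_three] at h1
  rcases h.dichotomy with ⟨hα, rfl⟩ | ⟨rfl, rfl, h3⟩
  · have h1 := T_map h.norm_map h.map_c (S.sharp v) S.c
    rw [h.map_c, ← sharp_map h.surjective h.norm_map h.map_c, h.map_v, zero_smul, add_zero,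
      S.sharp_smul] at h1
    simp only [map_smul, LinearMap.smul_apply, smul_eq_mul] at h1
    have h2 : (α - 1) * S.T (S.sharp v) S.c = 0 := by
      linear_combination -α * h1 + S.T (S.sharp v) S.c * h.pow_three
    rw [(mul_eq_zero.1 h2).resolve_left (sub_ne_zero.2 hα), neg_zero]
  · linear_combination h1

lemma map_sharp_v (h : S.IsTwisted φ α β v) :
    φ (S.sharp v) = α ^ 2 • S.sharp v - (α * β) • v + β ^ 2 • S.c := by
  rw [← sharp_map h.surjective h.norm_map h.map_c, h.map_v, S.sharp_add, S.sharp_smul,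
    S.sharp_smul, S.sharp_c, S.smul_cross, S.cross_smul, S.cross_comm, S.c_cross, h.T_v_c,
    zero_smul, zero_sub]
  module

lemma map_mem_orth (h : S.IsTwisted φ α β v) {x : J} (hx : x ∈ S.orth v) : φ x ∈ S.orth v := by
  obtain ⟨⟨h1, h2⟩, h3⟩ := mem_orth.1 hx
  have e1 := T_map h.norm_map h.map_c S.c x
  have e2 := T_map h.norm_map h.map_c v x
  have e3 := T_map h.norm_map h.map_c (S.sharp v) x
  rw [h.map_c, h1] at e1
  rw [h.map_v, h2] at e2
  rw [h.map_sharp_v, h3] at e3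
  simp only [map_add, map_sub, map_smul, LinearMap.add_apply, LinearMap.sub_apply,
    LinearMap.smul_apply, smul_eq_mul, e1, mul_zero, add_zero] at e2 e3
  have e2' := (mul_eq_zero.1 e2).resolve_left h.ne_zero
  rw [e2', mul_zero, sub_zero] at e3
  exact ⟨⟨e1, e2'⟩, (mul_eq_zero.1 e3).resolve_left (pow_ne_zero 2 h.ne_zero)⟩

lemma cross_mem_orth (h : S.IsTwisted φ α β v) {x : J} (hx : x ∈ S.orth v) :
    S.cross v x ∈ S.orth v := by
  obtain ⟨⟨h1, h2⟩, h3⟩ := mem_orth.1 hx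
  refine ⟨⟨?_, ?_⟩, ?_⟩
  · change S.T S.c (S.cross v x) = 0
    rw [S.T_comm, S.T_cross_right_comm, S.cross_comm, S.c_cross, h.T_v_c]
    simp [h2]
  · change S.T v (S.cross v x) = 0
    rw [S.T_comm, S.T_cross_right_comm, S.cross_self]
    simp [h3]
  · change S.T (S.sharp v) (S.cross v x) = 0
    rw [S.T_comm, S.T_cross_right_comm, S.cross_sharp_self]
    simp [h1, h2, h3]

lemma map_cross (h : S.IsTwisted φ α β v) {x : J} (hx : x ∈ S.orth v) :
    φ (S.cross v x) = α • S.cross v (φ x) - β • φ x := by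
  rw [← cross_map h.surjective h.norm_map h.map_c, h.map_v, S.add_cross, S.smul_cross,
    S.smul_cross, S.c_cross_of_mem_orth (h.map_mem_orth hx)]
  module

lemma eq_zero_of_fixed (h : S.IsTwisted φ α β v)
    (hfix : ∀ x, φ x = x → x ∈ Submodule.span k {S.c}) {x : J} (hx : x ∈ S.orth v)
    (hφ : φ x = x) : x = 0 := by
  obtain ⟨t, rfl⟩ := Submodule.mem_span_singleton.1 (hfix x hφ)
  obtain ⟨⟨h1, h2⟩, h3⟩ := mem_orth.1 hx
  rw [map_smul, smul_eq_mul, S.T_c_c] at h1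
  rw [map_smul, smul_eq_mul, h.T_sharp_c] at h3
  have : t = 0 := by
    rcases h.dichotomy with ⟨hα, -⟩ | ⟨-, rfl, -⟩
    · refine (mul_eq_zero.1 h1).resolve_right fun h3 => hα ?_
      have h4 : (α - 1) ^ 2 = 0 := by linear_combination h.quadratic - α * h3
      exact sub_eq_zero.1 (pow_eq_zero_iff two_ne_zero |>.1 h4)
    · simpa using h3
  rw [this, zero_smul]

lemma eq_zero_of_cube_fixed (h : S.IsTwisted φ α β v)
    (hfix : ∀ x, φ x = x → x ∈ Submodule.span k {S.c}) {x : J} (hx : x ∈ S.orth v)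
    (hφ : φ (φ (φ x)) = x) : x = 0 := by
  have hV := h.map_mem_orth hx
  have hVV := h.map_mem_orth hV
  rcases h.dichotomy with ⟨hα, rfl⟩ | ⟨rfl, rfl, h3⟩
  · have hinj : ∀ y ∈ S.orth v, S.cross v y = 0 → y = 0 := fun y hy h0 => by
      have := S.sharp_cross_cross_of_mem_orth hy
      rw [h0, S.cross_zero] at this
      exact (smul_eq_zero.1 this.symm).resolve_left h.norm_ne_zero
    have hw : ∀ μ : k, x + μ • φ x + μ ^ 2 • φ (φ x) ∈ S.orth v := fun μ =>
      add_mem (add_mem hx (Submodule.smul_mem _ _ hV)) (Submodule.smul_mem _ _ hVV)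
    have hα4 : α ^ 4 = α := by linear_combination α * h.pow_three
    have e0 : x + (1 : k) • φ x + (1 : k) ^ 2 • φ (φ x) = 0 := by
      refine h.eq_zero_of_fixed hfix (hw 1) ?_
      simp only [map_add, map_smul, hφ]
      module
    have e1 : x + α • φ x + α ^ 2 • φ (φ x) = 0 := by
      refine hinj _ (hw _) (h.eq_zero_of_fixed hfix (h.cross_mem_orth (hw _)) ?_)
      rw [h.map_cross (hw _), zero_smul, sub_zero, ← S.cross_smul]
      congr 1
      simp only [map_add, map_smul, hφ]
      linear_combination (norm := module) h.pow_three • x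
    have e2 : x + (α ^ 2) • φ x + (α ^ 2) ^ 2 • φ (φ x) = 0 := by
      refine hinj _ (hw _) (hinj _ (h.cross_mem_orth (hw _)) (h.eq_zero_of_fixed hfix
        (h.cross_mem_orth (h.cross_mem_orth (hw _))) ?_))
      rw [h.map_cross (h.cross_mem_orth (hw _)), h.map_cross (hw _), zero_smul, zero_smul,
        sub_zero, sub_zero, ← S.cross_smul, ← S.cross_smul, ← S.cross_smul]
      congr 2
      simp only [map_add, map_smul, hφ]
      have h6 : α ^ 6 = 1 := by linear_combination (α ^ 3 + 1) * h.pow_three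
      linear_combination (norm := module) h6 • x
    have e3 : (3 : k) • x = (0 : k) • x := by
      have hq : (α ^ 2) ^ 2 = α := by linear_combination hα4
      have hq' := h.quadratic
      rw [hq] at e2
      linear_combination (norm := module) e0 + e1 + e2 - hq' • φ x - hq' • φ (φ x)
    have h3 : (3 : k) ≠ 0 := fun h3 => hα <| by
      have h4 : (α - 1) ^ 2 = 0 := by linear_combination h.quadratic - α * h3
      exact sub_eq_zero.1 (pow_eq_zero_iff two_ne_zero |>.1 h4)
    rw [zero_smul] at e3
    exact (smul_eq_zero.1 e3).resolve_left h3
  · have e2 : φ (φ x - x) - (φ x - x) = 0 := by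
      refine h.eq_zero_of_fixed hfix (sub_mem (h.map_mem_orth (sub_mem hV hx)) (sub_mem hV hx)) ?_
      simp only [map_sub, hφ]
      linear_combination (norm := module) h3 • (φ x - φ (φ x))
    have e1 : φ x - x = 0 :=
      h.eq_zero_of_fixed hfix (sub_mem hV hx) (sub_eq_zero.1 e2)
    exact h.eq_zero_of_fixed hfix hx (sub_eq_zero.1 e1)

lemma eq_zero_of_cube_eigenvector (h : S.IsTwisted φ α β v) (hdiv : ∀ x, x ≠ 0 → S.N x ≠ 0)
    (hfix : ∀ x, φ x = x → x ∈ Submodule.span k {S.c}) {a : k} (ha : a ^ 3 = 1) {x : J}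
    (hx : x ∈ S.orth v) (hφ : φ (φ (φ x)) = a • x) : x = 0 := by
  by_contra hx0
  have ha1 : a ≠ 1 := fun h1 => hx0 (h.eq_zero_of_cube_fixed hfix hx (by rw [hφ, h1, one_smul]))
  obtain ⟨hα, rfl⟩ : α ≠ 1 ∧ β = 0 := by
    refine h.dichotomy.resolve_right fun ⟨h1, _, h3⟩ => ha1 ?_
    have h2 : (a - 1) ^ 3 = 0 := by linear_combination ha - (a ^ 2 - a) * h3
    exact sub_eq_zero.1 (pow_eq_zero_iff three_ne_zero |>.1 h2)
  have h3 : (3 : k) ≠ 0 := fun h3 => hα <| by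
    have h4 : (α - 1) ^ 2 = 0 := by linear_combination h.quadratic - α * h3
    exact sub_eq_zero.1 (pow_eq_zero_iff two_ne_zero |>.1 h4)
  have hNx := hdiv x hx0
  have hNv := h.norm_ne_zero
  have hTvc := h.T_v_c
  have hTsc : S.T (S.sharp v) S.c = 0 := by rw [h.T_sharp_c, neg_zero]
  have hTcv : S.T S.c v = 0 := by rw [S.T_comm, hTvc]
  have hTcs : S.T S.c (S.sharp v) = 0 := by rw [S.T_comm, hTsc]
  have hmv : φ v = α • v := by rw [h.map_v, zero_smul, add_zero]
  have hms : φ (S.sharp v) = α ^ 2 • S.sharp v := by rw [h.map_sharp_v]; module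
  have hTvv : S.T v v = 0 := by
    have e := T_map h.norm_map h.map_c v v
    simp only [hmv, map_smul, LinearMap.smul_apply, smul_eq_mul] at e
    have e' : (α - 1) * S.T v v = 0 := by
      linear_combination -α * e + S.T v v * h.pow_three
    exact (mul_eq_zero.1 e').resolve_left (sub_ne_zero.2 hα)
  have hTss : S.T (S.sharp v) (S.sharp v) = 0 := by
    have e := T_map h.norm_map h.map_c (S.sharp v) (S.sharp v)
    simp only [hms, map_smul, LinearMap.smul_apply, smul_eq_mul] at e
    have e' : (α - 1) * S.T (S.sharp v) (S.sharp v) = 0 := by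
      linear_combination e - α * S.T (S.sharp v) (S.sharp v) * h.pow_three
    exact (mul_eq_zero.1 e').resolve_left (sub_ne_zero.2 hα)
  have hTsv : S.T (S.sharp v) v = 3 * S.N v := S.T_sharp_self v
  have hmcube : ∀ y z, φ (φ (φ (S.cross y z))) = S.cross (φ (φ (φ y))) (φ (φ (φ z))) := by
    intro y z
    simp only [cross_map h.surjective h.norm_map h.map_c]
  have hscube : ∀ y, φ (φ (φ (S.sharp y))) = S.sharp (φ (φ (φ y))) := by
    intro y
    simp only [sharp_map h.surjective h.norm_map h.map_c]
  set b := S.cross (S.sharp x) (φ x) with hb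
  have hbfix : φ (φ (φ b)) = b := by
    rw [hb, hmcube, hscube, hφ, map_smul, S.sharp_smul, S.smul_cross, S.cross_smul]
    linear_combination (norm := module) ha • S.cross (S.sharp x) (φ x)
  -- The fixed points of `φ ^ 3` are spanned by `c`, `v` and `v^#`.
  obtain ⟨b₀, b₁, b₂, hbb⟩ : ∃ b₀ b₁ b₂ : k, b = b₀ • S.c + b₁ • v + b₂ • S.sharp v := by
    refine ⟨S.T S.c b / 3, S.T (S.sharp v) b / (3 * S.N v), S.T v b / (3 * S.N v), ?_⟩
    rw [← sub_eq_zero]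
    refine h.eq_zero_of_cube_fixed hfix (mem_orth.2 ⟨⟨?_, ?_⟩, ?_⟩) ?_
    · simp only [map_sub, map_add, map_smul, smul_eq_mul, S.T_c_c, hTcv, hTcs]
      field_simp
      ring
    · simp only [map_sub, map_add, map_smul, smul_eq_mul, hTvc, hTvv, S.T_comm v (S.sharp v), hTsv]
      field_simp
      ring
    · simp only [map_sub, map_add, map_smul, smul_eq_mul, hTss, hTsc, hTsv]
      field_simp
      ring
    · have h6 : α ^ 6 = 1 := by linear_combination (α ^ 3 + 1) * h.pow_three
      simp only [map_sub, map_add, map_smul, hbfix, h.map_c, hmv, hms]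
      linear_combination (norm := module)
        -(S.T (S.sharp v) b / (3 * S.N v)) • h.pow_three • v
          - (S.T v b / (3 * S.N v)) • h6 • S.sharp v
  have hTxφ : S.T x (φ x) = 0 := by
    have e1 : S.T (φ (φ (φ x))) (φ (φ (φ (φ x)))) = S.T x (φ x) := by
      rw [T_map h.norm_map h.map_c, T_map h.norm_map h.map_c, T_map h.norm_map h.map_c]
    rw [hφ, map_smul, map_smul, map_smul, LinearMap.smul_apply, smul_eq_mul, smul_eq_mul] at e1
    have e' : (a - 1) * S.T x (φ x) = 0 := by
      linear_combination -a * e1 + S.T x (φ x) * ha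
    exact (mul_eq_zero.1 e').resolve_left (sub_ne_zero.2 ha1)
  have hxb : S.cross b x = S.N x • φ x := by
    rw [S.cross_comm, hb, S.cross_sharp_cross hNx, hTxφ, zero_smul, add_zero]
  have hsv : ∀ y ∈ S.orth v, S.cross (S.sharp v) y = -S.cross v (S.cross v y) := by
    intro y hy
    have e := S.cross_cross_self v y
    have hvc : S.cross v S.c = -v := by rw [S.cross_comm, S.c_cross, hTvc, zero_smul, zero_sub]
    rw [hTvc, hTsc, S.c_cross_of_mem_orth hy, hvc, (mem_orth.1 hy).2, S.cross_neg] at e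
    simp only [map_neg, LinearMap.neg_apply, (mem_orth.1 hy).1.2] at e
    linear_combination (norm := module) -e
  have hW : ∀ y ∈ S.orth v, S.cross v (S.cross v (S.cross v y)) = -(S.N v • y) := by
    intro y hy
    rw [← S.sharp_cross_cross_of_mem_orth hy, hsv _ (h.cross_mem_orth hy), neg_neg]
  have hV := h.map_mem_orth hx
  have hVV := h.map_mem_orth hV
  have hmW : ∀ y ∈ S.orth v, φ (S.cross v y) = α • S.cross v (φ y) := by
    intro y hy
    rw [h.map_cross hy, zero_smul, sub_zero]
  have E1 : S.N x • φ x = -(b₀ • x) + b₁ • S.cross v x - b₂ • S.cross v (S.cross v x) := by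
    rw [← hxb, hbb, S.add_cross, S.add_cross, S.smul_cross, S.smul_cross, S.smul_cross,
      S.c_cross_of_mem_orth hx, hsv x hx]
    module
  have E2 : S.N x • φ (φ x) = -(b₀ • φ x) + (α * b₁) • S.cross v (φ x)
      - (α ^ 2 * b₂) • S.cross v (S.cross v (φ x)) := by
    have := congrArg φ E1
    simp only [map_smul, map_add, map_sub, map_neg, hmW _ hx, hmW _ (h.cross_mem_orth hx),
      S.cross_smul] at this
    rw [this]
    module
  have E3 : S.N x • φ (φ (φ x)) = -(b₀ • φ (φ x)) + (α ^ 2 * b₁) • S.cross v (φ (φ x))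
      - (α ^ 4 * b₂) • S.cross v (S.cross v (φ (φ x))) := by
    have := congrArg φ E2
    simp only [map_smul, map_add, map_sub, map_neg, hmW _ hV, hmW _ (h.cross_mem_orth hV),
      S.cross_smul] at this
    rw [this]
    module
  have hcube : (S.N x ^ 3 * a) • x = -(b₀ ^ 3 + S.N v * b₁ ^ 3 + S.N v ^ 2 * b₂ ^ 3
      - 3 * S.N v * b₀ * b₁ * b₂) • x := by
    have hWs : ∀ p₀ p₁ p₂ : k, S.cross v (p₀ • x + p₁ • S.cross v x
        + p₂ • S.cross v (S.cross v x)) = (-S.N v * p₂) • x + p₀ • S.cross v x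
          + p₁ • S.cross v (S.cross v x) := by
      intro p₀ p₁ p₂
      simp only [S.cross_add, S.cross_smul, hW x hx]
      module
    have hstep : ∀ {y z : J} {r₀ r₁ r₂ p₀ p₁ p₂ m : k}, m • y = p₀ • x + p₁ • S.cross v x
        + p₂ • S.cross v (S.cross v x) → S.N x • z = -(r₀ • y) + r₁ • S.cross v y
          - r₂ • S.cross v (S.cross v y) → (m * S.N x) • z =
            (-r₀ * p₀ - S.N v * r₁ * p₂ + S.N v * r₂ * p₁) • x
            + (-r₀ * p₁ + r₁ * p₀ + S.N v * r₂ * p₂) • S.cross v x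
            + (-r₀ * p₂ + r₁ * p₁ - r₂ * p₀) • S.cross v (S.cross v x) := by
      intro y z r₀ r₁ r₂ p₀ p₁ p₂ m h1 h2
      have h1' := congrArg (S.cross v) h1
      rw [S.cross_smul, hWs] at h1'
      have h1'' := congrArg (S.cross v) h1'
      rw [S.cross_smul, hWs] at h1''
      linear_combination (norm := module) m • h2 - r₀ • h1 + r₁ • h1' - r₂ • h1''
    have F1 : S.N x • φ x = (-b₀) • x + b₁ • S.cross v x + (-b₂) • S.cross v (S.cross v x) := by
      rw [E1]; module
    have F3 := hstep (hstep F1 E2) E3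
    rw [hφ] at F3
    have hq := h.quadratic
    linear_combination (norm := skip) F3
    match_scalars <;> clear * - hq <;> grind
  have hNs : S.N (S.sharp v) = S.N v ^ 2 := by
    have := S.T_sharp_self (S.sharp v)
    rw [S.adjoint, map_smul, LinearMap.smul_apply, smul_eq_mul, S.T_comm, hTsv] at this
    exact mul_left_cancel₀ h3 (by linear_combination -this)
  have hvs : S.cross v (S.sharp v) = -(S.N v • S.c) := by
    rw [S.cross_sharp_self, hTvc, hTsc]
    module
  have hys : S.sharp (b₁ • v + b₂ • S.sharp v) =
      b₁ ^ 2 • S.sharp v + (b₂ ^ 2 * S.N v) • v - (b₁ * b₂ * S.N v) • S.c := by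
    rw [S.sharp_add, S.sharp_smul, S.sharp_smul, S.adjoint, S.smul_cross, S.cross_smul, hvs]
    module
  have hNb : S.N b = b₀ ^ 3 + S.N v * b₁ ^ 3 + S.N v ^ 2 * b₂ ^ 3
      - 3 * S.N v * b₀ * b₁ * b₂ := by
    rw [hbb, add_assoc, S.N_add, hys, S.N_add, S.N_smul, S.N_smul, S.N_smul, S.base, S.sharp_smul,
      S.sharp_smul, S.sharp_smul, S.sharp_c, S.adjoint, hNs]
    simp only [map_add, map_sub, map_smul, LinearMap.smul_apply, smul_eq_mul, S.T_c_c, hTcv, hTcs,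
      hTss, hTvv]
    ring
  have hTbx : S.T (S.sharp b) x = 0 := by
    obtain ⟨⟨h1, h2⟩, h4⟩ := mem_orth.1 hx
    rw [hbb, add_assoc, S.sharp_add, hys, S.sharp_smul, S.sharp_c, S.smul_cross, S.c_cross]
    simp [h1, h2, h4]
  have hφx : φ x ≠ 0 := fun h0 => hNx (by rw [← h.norm_map, h0, S.N_zero])
  have hb0 : b ≠ 0 := fun h0 => by
    rw [h0, S.zero_cross] at hxb
    exact (smul_ne_zero hNx hφx) hxb.symm
  have hNN := S.N_cross (hdiv b hb0) hNx
  rw [hxb, S.N_smul, h.norm_map, hTbx, zero_mul, zero_sub, ← neg_mul] at hNN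
  have hNN' := mul_right_cancel₀ hNx hNN
  rw [← hNb, ← hNN'] at hcube
  have := smul_left_injective k hx0 hcube
  exact ha1 (mul_left_cancel₀ (pow_ne_zero 3 hNx) (this.trans (mul_one _).symm))

end IsTwisted

end CubicNorm

namespace CubicNorm

open Polynomial

variable {k ι : Type*} [Field k] [Fintype ι] (S : CubicNorm k (ι → k))

/-- An operator whose eigenvalue `1` has multiplicity at least two and whose fixed points lie in
the line spanned by `c` is unipotent, but not trivial, on some plane through `c`. -/
lemma exists_map_sub_mem_span {M : Type*} [AddCommGroup M] [Module k M] [FiniteDimensional k M]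
    (φ : M →ₗ[k] M) {c : M} (hroot : 1 < φ.charpoly.rootMultiplicity 1)
    (hfix : ∀ x, φ x = x → x ∈ Submodule.span k {c}) : ∃ v, φ v = v + c := by
  rw [← LinearMap.finrank_maxGenEigenspace_eq] at hroot
  obtain ⟨w, hw, hwc⟩ : ∃ w ∈ Module.End.maxGenEigenspace φ 1, w ∉ Submodule.span k {c} := by
    by_contra! hle
    exact absurd ((Submodule.finrank_mono hle).trans
      ((finrank_span_le_card {c}).trans (by simp))) (not_le.2 hroot)
  obtain ⟨n, hn⟩ := (Module.End.mem_maxGenEigenspace _ _ _).1 hw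
  rw [one_smul] at hn
  clear hw
  induction n generalizing w with
  | zero => exact absurd (by simpa using hn) (fun h0 : w = 0 => hwc (h0 ▸ zero_mem _))
  | succ n ih =>
    by_cases h : (φ - 1) w ∈ Submodule.span k {c}
    · obtain ⟨t, ht⟩ := Submodule.mem_span_singleton.1 h
      have hφ : φ w = w + t • c := by rw [ht]; simp
      have ht0 : t ≠ 0 := fun h0 => hwc (hfix w (by rw [hφ, h0, zero_smul, add_zero]))
      refine ⟨t⁻¹ • w, ?_⟩
      rw [map_smul, hφ, smul_add, smul_smul, inv_mul_cancel₀ ht0, one_smul]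
    · exact ih _ h (by rwa [pow_succ, Module.End.mul_apply] at hn)

lemma minpoly_restrict_pow_dvd {M : Type*} [AddCommGroup M] [Module k M] [FiniteDimensional k M]
    (φ : M →ₗ[k] M) (V : Submodule k M) (hV : ∀ x ∈ V, φ x ∈ V) (n : ℕ) :
    minpoly k ((φ.restrict hV) ^ n) ∣ LinearMap.charpoly (φ ^ n) := by
  refine minpoly.dvd _ _ (LinearMap.ext fun x => Subtype.ext ?_)
  rw [Module.End.pow_restrict n, coe_aeval_restrict, LinearMap.aeval_self_charpoly]
  rfl

/-- The orthogonal complement of `c`, `v` and `v^#` has dimension `24`, `25` or `26` when the whole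
space has dimension `27`. -/
lemma not_nine_dvd_finrank_orth (h27 : Fintype.card ι = 27) (v : ι → k) :
    ¬ 9 ∣ Module.finrank k (S.orth v) := by
  let f : (ι → k) →ₗ[k] (k × k) × k := ((S.T S.c).prod (S.T v)).prod (S.T (S.sharp v))
  have hf : LinearMap.ker f = S.orth v := by
    ext x
    simp [f, mem_orth]
  have h1 := f.finrank_range_add_finrank_ker
  have h2 := (LinearMap.range f).finrank_le
  rw [hf, Module.finrank_fintype_fun_eq_card, h27] at h1
  simp only [Module.finrank_prod, Module.finrank_self] at h2
  have h3 : Module.finrank k (LinearMap.range f) ≠ 0 := fun h0 => by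
    rw [Submodule.finrank_eq_zero, LinearMap.range_eq_bot] at h0
    refine S.c_ne_zero (S.nondeg _ fun y => ?_)
    have := LinearMap.congr_fun h0 y
    exact congrArg (fun z : (k × k) × k => z.1.1) this
  omega

variable [Infinite k] [DecidableEq ι]

lemma exists_isTwisted (h27 : Fintype.card ι = 27) {α : k} (hα : α ^ 2 + α + 1 = 0)
    (hdiv : ∀ x, x ≠ 0 → S.N x ≠ 0) (φ : (ι → k) →ₗ[k] (ι → k))
    (hN : ∀ x, S.N (φ x) = S.N x) (hc : φ S.c = S.c)
    (hfix : ∀ x, φ x = x → x ∈ Submodule.span k {S.c}) :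
    ∃ α β v, S.IsTwisted φ α β v := by
  have hsurj : Function.Surjective φ := by
    refine LinearMap.surjective_of_injective ((injective_iff_map_eq_zero φ).2 fun x hx => ?_)
    by_contra h0
    exact hdiv x h0 (by rw [← hN, hx, S.N_zero])
  have hroot : φ.charpoly.IsRoot 1 := by
    rw [← Module.End.hasEigenvalue_iff_isRoot_charpoly]
    exact Module.End.hasEigenvalue_of_hasEigenvector (x := S.c)
      ⟨Module.End.mem_eigenspace_iff.2 (by rw [hc, one_smul]), S.c_ne_zero⟩
  have hdeg : φ.charpoly.natDegree = 27 := by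
    rw [LinearMap.charpoly_natDegree, Module.finrank_fintype_fun_eq_card, h27]
  have hχ0 : φ.charpoly ≠ 0 := φ.charpoly_monic.ne_zero
  obtain ⟨s, hs⟩ := dvd_iff_isRoot.2 hroot
  have hs0 : s ≠ 0 := fun h0 => hχ0 (by rw [hs, h0, mul_zero])
  have hsdeg : ¬ 3 ∣ s.natDegree := by
    rw [hs, natDegree_mul (X_sub_C_ne_zero 1) hs0, natDegree_X_sub_C] at hdeg
    omega
  obtain ⟨p, r, n, hp, hspr, -, hn, hp3⟩ := exists_irreducible_pow_mul s hs0 hsdeg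
  have hps : p ∣ s := by
    rw [hspr]
    exact (dvd_pow_self p (by rintro rfl; simp at hn)).mul_right r
  obtain ⟨a, ha, hpa⟩ := exists_of_dvd_X_pow_three_sub_one hα hp
    (S.dvd_X_pow_three_sub_one hdiv φ hN hp hp3 (hps.trans ⟨_, hs.trans (mul_comm _ _)⟩))
  have has : X - C a ∣ s := hpa.symm.dvd.trans hps
  by_cases ha1 : a = 1
  · subst ha1
    have h2 : 1 < φ.charpoly.rootMultiplicity 1 := by
      refine (le_rootMultiplicity_iff hχ0).2 ?_
      rw [hs, pow_two]
      exact mul_dvd_mul_left _ has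
    obtain ⟨v, hv⟩ := exists_map_sub_mem_span φ h2 hfix
    have h3 : (3 : k) = 0 := by
      have h1 := T_map hN hc v S.c
      rw [hv, hc, map_add, LinearMap.add_apply, S.T_c_c] at h1
      linear_combination h1
    refine ⟨1, 1, v, hN, hc, hsurj, by linear_combination h3, Or.inr ⟨rfl, rfl, h3⟩,
      by rw [hv, one_smul, one_smul], hdiv v ?_⟩
    rintro rfl
    rw [map_zero, zero_add] at hv
    exact S.c_ne_zero hv.symm
  · have : Module.End.HasEigenvalue φ a := by
      rw [Module.End.hasEigenvalue_iff_isRoot_charpoly, ← dvd_iff_isRoot]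
      exact has.trans ⟨_, hs.trans (mul_comm _ _)⟩
    obtain ⟨v, hv, hv0⟩ := this.exists_hasEigenvector
    refine ⟨a, 0, v, hN, hc, hsurj, ?_, Or.inl ⟨ha1, rfl⟩, ?_, hdiv v hv0⟩
    · exact (mul_eq_zero.1 (show (a - 1) * (a ^ 2 + a + 1) = 0 by
        linear_combination ha)).resolve_left (sub_ne_zero.2 ha1)
    · rw [Module.End.mem_eigenspace_iff.1 hv, zero_smul, add_zero]

/-- The theorem when `k` contains the cube roots of unity. -/
theorem exists_fixed_of_cube_root (h27 : Fintype.card ι = 27) {α : k} (hα : α ^ 2 + α + 1 = 0)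
    (hdiv : ∀ x, x ≠ 0 → S.N x ≠ 0) (φ : (ι → k) →ₗ[k] (ι → k))
    (hN : ∀ x, S.N (φ x) = S.N x) (hc : φ S.c = S.c) :
    ∃ x, φ x = x ∧ x ∉ Submodule.span k {S.c} := by
  by_contra! hfix
  obtain ⟨α', β, v, h⟩ := S.exists_isTwisted h27 hα hdiv φ hN hc hfix
  have hφ0 : ∀ x, φ x = 0 → x = 0 := fun x hx => by
    by_contra h0
    exact hdiv x h0 (by rw [← hN, hx, S.N_zero])
  let φV : S.orth v →ₗ[k] S.orth v := φ.restrict fun x hx => h.map_mem_orth hx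
  let R : S.orth v →ₗ[k] S.orth v := (-S.crossₗ v).restrict fun x hx =>
    neg_mem (h.cross_mem_orth hx)
  have hφV : ∀ x, ((φV x : S.orth v) : ι → k) = φ x := fun x => rfl
  have hRV : ∀ x, ((R x : S.orth v) : ι → k) = -S.cross v x := fun x => rfl
  have hφR : ∀ x, φV (R x) = α' • R (φV x) + β • φV x := fun x => by
    ext1
    simp only [Submodule.coe_add, Submodule.coe_smul, hφV, hRV, map_neg, h.map_cross x.2]
    module
  have hφinj : Function.Injective φV := (injective_iff_map_eq_zero φV).2 fun x hx =>
    Subtype.ext (hφ0 x (congrArg Subtype.val hx))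
  have hRinj : Function.Injective R := (injective_iff_map_eq_zero R).2 fun x hx => by
    have h0 : -S.cross v x = 0 := congrArg Subtype.val hx
    have h1 := S.sharp_cross_cross_of_mem_orth x.2
    rw [neg_eq_zero.1 h0, S.cross_zero] at h1
    exact Subtype.ext ((smul_eq_zero.1 h1.symm).resolve_left h.norm_ne_zero)
  have hψR : Commute (φV ^ 3) R := by
    ext1 x
    simp only [pow_three, Module.End.mul_apply, hφR, map_add, map_smul]
    have h1 := h.pow_three
    have h2 := h.quadratic
    linear_combination (norm := module) h1 • R (φV (φV (φV x))) + (β • h2) • φV (φV (φV x))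
  have hint : IsIntegral k (φV ^ 3) := Algebra.IsIntegral.isIntegral _
  have hmin : aeval (φV ^ 3) (minpoly k (φV ^ 3)) = 0 := minpoly.aeval k (φV ^ 3)
  by_cases hq : ∀ g, Irreducible g → g ∣ minpoly k (φV ^ 3) → 3 ∣ g.natDegree
  · exact S.not_nine_dvd_finrank_orth h27 v
      (nine_dvd_finrank α' β h.pow_three h.dichotomy _ (minpoly.ne_zero hint) hq R φV (φV ^ 3)
        hψR ((Commute.refl φV).pow_left 3) hφinj hRinj hφR hmin)
  push Not at hq
  obtain ⟨g, hg, hgm, hg3⟩ := hq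
  have hmφ : minpoly k (φV ^ 3) ∣ LinearMap.charpoly (φ ^ 3) :=
    minpoly_restrict_pow_dvd φ (S.orth v) _ 3
  obtain ⟨a, ha, hga⟩ := exists_of_dvd_X_pow_three_sub_one hα hg
    (S.dvd_X_pow_three_sub_one hdiv (φ ^ 3) (fun x => by
      simp only [pow_three, Module.End.mul_apply, hN]) hg hg3 (hgm.trans hmφ))
  obtain ⟨u, hu, hu0⟩ := (Module.End.hasEigenvalue_of_isRoot
    (dvd_iff_isRoot.1 (hga.symm.dvd.trans hgm))).exists_hasEigenvector
  have hu1 := Module.End.mem_eigenspace_iff.1 hu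
  refine hu0 (Subtype.ext (h.eq_zero_of_cube_eigenvector hdiv hfix ha u.2 ?_))
  simpa [pow_three, Module.End.mul_apply, hφV] using congrArg Subtype.val hu1

end CubicNorm

namespace CubicNorm

open Polynomial

variable {k ι : Type*} [Field k] [Fintype ι] [DecidableEq ι] (S : CubicNorm k (ι → k))
  (L : Type*) [Field L] [Algebra k L]

/-- The trace form with coordinates in a commutative algebra, as a bilinear map. -/
noncomputable def TExtₗ : (ι → L) →ₗ[L] (ι → L) →ₗ[L] L :=
  LinearMap.mk₂ L S.TExt
    (fun x y z => by
      simp only [TExt, Pi.add_apply, mul_add, add_mul, Finset.sum_add_distrib])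
    (fun t x y => by
      simp only [TExt, Pi.smul_apply, smul_eq_mul, Finset.mul_sum]
      exact Finset.sum_congr rfl fun _ _ => Finset.sum_congr rfl fun _ _ => by ring)
    (fun x y z => by
      simp only [TExt, Pi.add_apply, mul_add, Finset.sum_add_distrib])
    (fun t x y => by
      simp only [TExt, Pi.smul_apply, smul_eq_mul, Finset.mul_sum]
      exact Finset.sum_congr rfl fun _ _ => Finset.sum_congr rfl fun _ _ => by ring)

variable {L}

lemma dual_TExt (f : Module.Dual k L) (x : ι → L) (y : ι → k) :
    f (S.TExt x fun i => algebraMap k L (y i)) = S.T (fun i => f (x i)) y := by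
  rw [← S.TExt_self]
  simp only [TExt, map_sum, Algebra.algebraMap_self, RingHom.id_apply]
  refine Finset.sum_congr rfl fun i _ => Finset.sum_congr rfl fun j _ => ?_
  rw [mul_right_comm, ← map_mul, ← Algebra.smul_def, map_smul, smul_eq_mul]
  ring

lemma dual_mulVec (M : Matrix ι ι k) (f : Module.Dual k L) (x : ι → L) (i : ι) :
    f ((M.map (algebraMap k L)).mulVec x i) = M.mulVec (fun i => f (x i)) i := by
  simp only [Matrix.mulVec, dotProduct, map_sum, Matrix.map_apply, ← Algebra.smul_def, map_smul,
    smul_eq_mul]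

variable (L) [Infinite k]

/-- Extension of scalars of a cubic norm structure. -/
noncomputable def baseChange : CubicNorm L (ι → L) where
  c := S.cExt L
  N := S.NExt
  T := S.TExtₗ L
  sharp := S.sharpExt
  base := S.NExt_cExt
  expand := S.NExt_add_smul
  nondeg x hx := by
    ext i
    refine (Module.forall_dual_apply_eq_zero_iff k (x i)).1 fun f => ?_
    have h := S.nondeg (fun i => f (x i)) fun y => by
      rw [← S.dual_TExt]
      exact (congrArg f (hx _)).trans (map_zero f)
    exact congrFun h i
  sharp_smul t x := funext (S.sharpExt_smul t x)
  adjoint x := funext (S.sharpExt_sharpExt x)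
  sharp_c := S.sharpExt_cExt
  cross_c x := funext fun i => by
    rw [S.sharpExt_cExt]
    exact S.sharpExt_cExt_add x i

/-- The coordinate version of the theorem. -/
theorem exists_fixed_of_card_eq (h27 : Fintype.card ι = 27)
    (hdiv : ∀ x, x ≠ 0 → S.N x ≠ 0) (φ : (ι → k) →ₗ[k] (ι → k))
    (hN : ∀ x, S.N (φ x) = S.N x) (hc : φ S.c = S.c) :
    ∃ x, φ x = x ∧ x ∉ Submodule.span k {S.c} := by
  by_cases hα : ∃ α : k, α ^ 2 + α + 1 = 0
  · obtain ⟨α, hα⟩ := hα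
    exact S.exists_fixed_of_cube_root h27 hα hdiv φ hN hc
  by_contra! hfix
  have hdeg : (X ^ 2 + X + 1 : k[X]).natDegree = 2 := by compute_degree!
  have hp : Irreducible (X ^ 2 + X + 1 : k[X]) := by
    refine irreducible_of_degree_le_three_of_not_isRoot (by rw [hdeg]; decide)
      fun a ha => hα ⟨a, ?_⟩
    simpa using ha
  have := Fact.mk hp
  let L := AdjoinRoot (X ^ 2 + X + 1 : k[X])
  have hroot : (AdjoinRoot.root (X ^ 2 + X + 1 : k[X])) ^ 2 + AdjoinRoot.root _ + 1 = 0 := by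
    have h := AdjoinRoot.mk_self (f := (X ^ 2 + X + 1 : k[X]))
    rwa [map_add, map_add, map_pow, AdjoinRoot.mk_X, map_one] at h
  have : Infinite L := Infinite.of_injective _ (algebraMap k L).injective
  set M := LinearMap.toMatrix' φ with hM
  have hMφ : ∀ x, M.mulVec x = φ x := fun x => LinearMap.toMatrix'_mulVec φ x
  obtain ⟨x, hx, hxc⟩ := (S.baseChange L).exists_fixed_of_cube_root h27 hroot
    (fun x hx h0 => hx (S.eq_zero_of_NExt_adjoinRoot hdiv _ hp (by rw [hdeg]; decide) x h0))
    (Matrix.mulVecLin (M.map (algebraMap k L)))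
    (fun x => S.NExt_mulVec M (fun x => by rw [hMφ, hN]) x) (by
      ext i
      have h := RingHom.map_mulVec (algebraMap k L) M S.c i
      rw [hMφ, hc] at h
      exact h.symm)
  refine hxc (Submodule.mem_span_singleton.2 ?_)
  obtain ⟨i, hi⟩ := Function.ne_iff.1 S.c_ne_zero
  refine ⟨x i / algebraMap k L (S.c i), funext fun j => ?_⟩
  change x i / algebraMap k L (S.c i) * algebraMap k L (S.c j) = x j
  have hi' : algebraMap k L (S.c i) ≠ 0 := by simpa using hi
  rw [div_mul_eq_mul_div, div_eq_iff hi', ← sub_eq_zero]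
  refine (Module.forall_dual_apply_eq_zero_iff k _).1 fun f => ?_
  have hf : φ (fun i => f (x i)) = fun i => f (x i) := by
    ext i
    rw [← hMφ, ← dual_mulVec]
    exact congrArg f (congrFun hx i)
  obtain ⟨t, ht⟩ := Submodule.mem_span_singleton.1 (hfix _ hf)
  have hti := congrFun ht i
  have htj := congrFun ht j
  simp only [Pi.smul_apply, smul_eq_mul] at hti htj
  rw [map_sub, mul_comm, mul_comm (x j), ← Algebra.smul_def, ← Algebra.smul_def, map_smul, map_smul,
    smul_eq_mul, smul_eq_mul, ← hti, ← htj]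
  ring

/-- Transport of a cubic norm structure along a linear equivalence. -/
def transport {J J' : Type*} [AddCommGroup J] [Module k J] [AddCommGroup J'] [Module k J']
    (S : CubicNorm k J) (e : J ≃ₗ[k] J') : CubicNorm k J' where
  c := e S.c
  N x := S.N (e.symm x)
  T := S.T.compl₁₂ e.symm.toLinearMap e.symm.toLinearMap
  sharp x := e (S.sharp (e.symm x))
  base := by simp [S.base]
  expand t x y := by simp [S.expand]
  nondeg x hx := by
    refine e.symm.map_eq_zero_iff.1 (S.nondeg _ fun y => ?_)
    simpa using hx (e y)
  sharp_smul t x := by simp [S.sharp_smul]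
  adjoint x := by simp [S.adjoint]
  sharp_c := by simp [S.sharp_c]
  cross_c x := by
    have := congrArg e (S.cross_c (e.symm x))
    simpa using this

end CubicNorm

/-- Let `A` be an Albert division algebra over `k` (a 27-dimensional
cubic norm structure with anisotropic norm) and `φ` an automorphism of `A` (a linear
bijection preserving the norm and fixing the identity element `c`).  Then `φ` fixes
pointwise some cubic subfield of `A`; equivalently, the fixed-point subalgebra `A^φ`
properly contains `k = k·c`: there is a fixed vector outside `k·c`. -/
theorem stmt13 {k J : Type*} [Field k] [AddCommGroup J] [Module k J]
    [FiniteDimensional k J] (S : CubicNorm k J)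
    (h27 : Module.finrank k J = 27)
    (hdiv : ∀ x : J, x ≠ 0 → S.N x ≠ 0)
    (φ : J ≃ₗ[k] J) (hN : ∀ x, S.N (φ x) = S.N x) (hc : φ S.c = S.c) :
    ∃ v : J, φ v = v ∧ v ∉ Submodule.span k ({S.c} : Set J) := by
  let e : J ≃ₗ[k] (Fin 27 → k) := (Module.finBasisOfFinrankEq k J h27).equivFun
  have hdiv' : ∀ x, x ≠ 0 → (S.transport e).N x ≠ 0 := fun x hx =>
    hdiv _ fun h => hx (e.symm.map_eq_zero_iff.1 h)
  have := (S.transport e).infinite_of_anisotropic (by simp) hdiv'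
  obtain ⟨x, hx, hxc⟩ := (S.transport e).exists_fixed_of_card_eq (by simp) hdiv'
    (e.toLinearMap ∘ₗ φ.toLinearMap ∘ₗ e.symm.toLinearMap)
    (fun x => by simp [CubicNorm.transport, hN]) (by simp [CubicNorm.transport, hc])
  refine ⟨e.symm x, ?_, fun h => hxc ?_⟩
  · simpa using congrArg e.symm hx
  · obtain ⟨t, ht⟩ := Submodule.mem_span_singleton.1 h
    refine Submodule.mem_span_singleton.2 ⟨t, ?_⟩
    change t • e S.c = x
    rw [← map_smul, ht, e.apply_symm_apply]
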